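/- (Proposition 5.1, volume form of the Hadamard formula for torsional rigidity.) Let 1 < p < ∞, let Ω ⊂ ℝ^N be a bounded domain with smooth boundary, let V : ℝ^N → ℝ^N be a smooth compactly supported vector field, and set Φ_t = id + tV and E(t) = E(Φ_t(Ω)). Let y, C^1 on the closure of Ω, vanishing on ∂Ω, be a weak solution of −Δ_p y = 1 in Ω. Then the map t ↦ E(t) is differentiable at t = 0 and E'(0) = (p/(p−1)) [ ∫_Ω (div V) y dx + ∫_Ω |∇y|^{p−2} ⟨(DV)ᵀ ∇y, ∇y⟩ dx − (1/p) ∫_Ω (div V) |∇y|^p dx ], where DV is the Jacobian matrix of V and (DV)ᵀ its transpose. -/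

import Mathlib

open MeasureTheory RealInnerProductSpace Metric Set

noncomputable section

/-- Smooth test functions compactly supported in `U` (the class `C_c^∞(U)`). -/
def IsTestFun {N : ℕ} (U : Set (EuclideanSpace ℝ (Fin N)))
    (φ : EuclideanSpace ℝ (Fin N) → ℝ) : Prop :=
  ContDiff ℝ (⊤ : ℕ∞) φ ∧ HasCompactSupport φ ∧ tsupport φ ⊆ U

/-- `u` is a weak solution of `-Δ_p u = h` in `U`:
`∫_U |∇u|^{p-2} ⟨∇u, ∇φ⟩ = ∫_U h φ` for all test functions `φ`. -/
def IsWeakSolution (p : ℝ) {N : ℕ} (U : Set (EuclideanSpace ℝ (Fin N)))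
    (u h : EuclideanSpace ℝ (Fin N) → ℝ) : Prop :=
  ∀ φ : EuclideanSpace ℝ (Fin N) → ℝ, IsTestFun U φ →
    (∫ x in U, ‖gradient u x‖ ^ (p - 2) * ⟪gradient u x, gradient φ x⟫)
      = ∫ x in U, h x * φ x

/-- The `p`-torsional rigidity of `U`:
`E(U) = (p/(p-1)) ⬝ sup { ∫_U φ - (1/p) ∫_U |∇φ|^p : φ ∈ C_c^∞(U) }`. -/
def pTorsionalRigidity (p : ℝ) {N : ℕ} (U : Set (EuclideanSpace ℝ (Fin N))) : ℝ :=
  (p / (p - 1)) *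
    sSup { r : ℝ | ∃ φ, IsTestFun U φ ∧
      r = (∫ x in U, φ x) - (1 / p) * ∫ x in U, ‖gradient φ x‖ ^ p }

/-- The first Dirichlet eigenvalue of the `p`-Laplacian on `U`:
`λ₁(U) = inf { (∫_U |∇φ|^p)/(∫_U |φ|^p) : φ ∈ C_c^∞(U), φ ≢ 0 }`. -/
def pLambda1 (p : ℝ) {N : ℕ} (U : Set (EuclideanSpace ℝ (Fin N))) : ℝ :=
  sInf { r : ℝ | ∃ φ, IsTestFun U φ ∧ φ ≠ 0 ∧
    r = (∫ x in U, ‖gradient φ x‖ ^ p) / (∫ x in U, |φ x| ^ p) }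

/-- `f` is `C^1` on the closure of `U` (i.e. `C^1` on an open neighbourhood of it). -/
def C1OnClosure {N : ℕ} (U : Set (EuclideanSpace ℝ (Fin N)))
    (f : EuclideanSpace ℝ (Fin N) → ℝ) : Prop :=
  ∃ W, IsOpen W ∧ closure U ⊆ W ∧ ContDiffOn ℝ 1 f W

/-- `Ω` has a smooth boundary: it is the sublevel set of a smooth function whose
differential does not vanish on the boundary. -/
def HasSmoothBoundary {N : ℕ} (Ω : Set (EuclideanSpace ℝ (Fin N))) : Prop :=
  ∃ f : EuclideanSpace ℝ (Fin N) → ℝ, ContDiff ℝ (⊤ : ℕ∞) f ∧ Ω = f ⁻¹' Set.Iio 0 ∧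
    ∀ x ∈ frontier Ω, fderiv ℝ f x ≠ 0

/-- The index of the first coordinate. -/
def firstIdx (N : ℕ) (hN : 2 ≤ N) : Fin N := ⟨0, by omega⟩

/-- The first standard basis vector `e₁`. -/
def e1v {N : ℕ} (hN : 2 ≤ N) : EuclideanSpace ℝ (Fin N) :=
  EuclideanSpace.single (firstIdx N hN) 1

/-- The domain `Ω(s) = B(0,r1) \ closure B(s e₁, r0)`. -/
def annulus {N : ℕ} (hN : 2 ≤ N) (r0 r1 s : ℝ) : Set (EuclideanSpace ℝ (Fin N)) :=
  Metric.ball (0 : EuclideanSpace ℝ (Fin N)) r1 \ closure (Metric.ball (s • e1v hN) r0)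

/-- Reflection across the hyperplane `{x₁ = s}`: `x ↦ (2s - x₁, x₂, …, x_N)`. -/
def reflectH {N : ℕ} (hN : 2 ≤ N) (s : ℝ) (x : EuclideanSpace ℝ (Fin N)) :
    EuclideanSpace ℝ (Fin N) :=
  x + (2 * (s - x (firstIdx N hN))) • e1v hN

/-- The divergence of a vector field, as the trace of its Jacobian. -/
def divergence {N : ℕ} (V : EuclideanSpace ℝ (Fin N) → EuclideanSpace ℝ (Fin N))
    (x : EuclideanSpace ℝ (Fin N)) : ℝ :=
  LinearMap.trace ℝ _ (fderiv ℝ V x : EuclideanSpace ℝ (Fin N) →ₗ[ℝ] EuclideanSpace ℝ (Fin N))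

/-- The classical `p`-Laplacian `Δ_p b = div(|∇b|^{p-2} ∇b)` at a point. -/
def pLapAt (p : ℝ) {N : ℕ} (b : EuclideanSpace ℝ (Fin N) → ℝ)
    (x : EuclideanSpace ℝ (Fin N)) : ℝ :=
  divergence (fun z => ‖gradient b z‖ ^ (p - 2) • gradient b z) x

/-- The torsion function of `U`: `C^1` up to the boundary, vanishing on the boundary,
positive inside, weak solution of `-Δ_p y = 1`. -/
def IsTorsionFn (p : ℝ) {N : ℕ} (U : Set (EuclideanSpace ℝ (Fin N)))
    (y : EuclideanSpace ℝ (Fin N) → ℝ) : Prop :=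
  C1OnClosure U y ∧ (∀ x ∈ frontier U, y x = 0) ∧ (∀ x ∈ U, 0 < y x) ∧
    IsWeakSolution p U y (fun _ => 1)

/-- A first eigenfunction of the Dirichlet `p`-Laplacian on `U`: `C^1` up to the boundary,
positive inside, vanishing on the boundary, `L^p`-normalized, weak solution of
`-Δ_p u = λ₁(U) u^{p-1}`. -/
def IsFirstEigenfun (p : ℝ) {N : ℕ} (U : Set (EuclideanSpace ℝ (Fin N)))
    (y : EuclideanSpace ℝ (Fin N) → ℝ) : Prop :=
  C1OnClosure U y ∧ (∀ x ∈ U, 0 < y x) ∧ (∀ x ∈ frontier U, y x = 0) ∧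
    (∫ x in U, y x ^ p) = 1 ∧
    IsWeakSolution p U y (fun x => pLambda1 p U * y x ^ (p - 1))

/-- The matrix `DA(x) = |x|^{p-2} I + (p-2)|x|^{p-4} x xᵀ`,
the derivative of `A(x) = |x|^{p-2} x`. -/
def DA (p : ℝ) {N : ℕ} (x : EuclideanSpace ℝ (Fin N)) :
    EuclideanSpace ℝ (Fin N) →L[ℝ] EuclideanSpace ℝ (Fin N) :=
  ‖x‖ ^ (p - 2) • ContinuousLinearMap.id ℝ (EuclideanSpace ℝ (Fin N)) +
    ((p - 2) * ‖x‖ ^ (p - 4)) • (innerSL ℝ x).smulRight x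

/-- `w` is a nonnegative bounded weak solution, continuous on the closure of `Ω` and `C^1`
inside, of `-Δ_p w = F(x, w)` in `Ω` with boundary value `bdry` on `∂Ω`. -/
def SolClass (p : ℝ) {N : ℕ} (Ω : Set (EuclideanSpace ℝ (Fin N)))
    (F : EuclideanSpace ℝ (Fin N) → ℝ → ℝ)
    (bdry w : EuclideanSpace ℝ (Fin N) → ℝ) : Prop :=
  ContinuousOn w (closure Ω) ∧ ContDiffOn ℝ 1 w Ω ∧
    (∀ x ∈ closure Ω, 0 ≤ w x) ∧ (∃ M, ∀ x ∈ closure Ω, |w x| ≤ M) ∧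
    IsWeakSolution p Ω w (fun x => F x (w x)) ∧ (∀ x ∈ frontier Ω, w x = bdry x)

section HadamardAuxiliary

open Filter Topology

namespace ContinuousLinearMap

theorem contDiff_det {E : Type*} [NormedAddCommGroup E] [NormedSpace ℝ E] [FiniteDimensional ℝ E]
    {n : WithTop ℕ∞} : ContDiff ℝ n (fun A : E →L[ℝ] E => A.det) := by
  let b := Module.finBasis ℝ E
  have h : (fun A : E →L[ℝ] E => A.det) =
      fun A => ∑ σ : Equiv.Perm (Fin (Module.finrank ℝ E)),
        (Equiv.Perm.sign σ : ℤ) • ∏ i, b.coord (σ i) (A (b i)) := by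
    ext A
    rw [ContinuousLinearMap.det, ← LinearMap.det_toMatrix b, Matrix.det_apply]
    simp only [LinearMap.toMatrix_apply, Module.Basis.coord_apply, Units.smul_def,
      ContinuousLinearMap.coe_coe]
  rw [h]
  refine ContDiff.sum fun σ _ => ?_
  simp only [zsmul_eq_mul]
  refine contDiff_const.mul (contDiff_prod fun i _ => ?_)
  have hc : ContDiff ℝ n (b.coord (σ i)) :=
    (LinearMap.toContinuousLinearMap (b.coord (σ i))).contDiff
  exact hc.comp (contDiff_id.clm_apply contDiff_const)

theorem hasDerivAt_det_one_add_smul {E : Type*} [NormedAddCommGroup E] [NormedSpace ℝ E]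
    [FiniteDimensional ℝ E] (M : E →L[ℝ] E) :
    HasDerivAt (fun t : ℝ => (1 + t • M).det) (LinearMap.trace ℝ E M) 0 := by
  let b := Module.finBasis ℝ E
  let A := LinearMap.toMatrix b b (M : E →ₗ[ℝ] E)
  obtain ⟨P, hP⟩ : ∃ P : Polynomial ℝ, ∀ t : ℝ, (1 + t • M).det = 1 + A.trace * t +
      P.eval t * t ^ 2 := by
    refine ⟨(Matrix.det (1 + (Polynomial.X : Polynomial ℝ) • A.map Polynomial.C)).divX.divX,
      fun t => ?_⟩
    rw [ContinuousLinearMap.det, ← LinearMap.det_toMatrix b]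
    have h : LinearMap.toMatrix b b ((1 + t • M : E →L[ℝ] E) : E →ₗ[ℝ] E) = 1 + t • A := by
      have h1 : ((1 + t • M : E →L[ℝ] E) : E →ₗ[ℝ] E) = LinearMap.id + t • (M : E →ₗ[ℝ] E) := rfl
      rw [h1, map_add, map_smul, LinearMap.toMatrix_id]
    rw [h, Matrix.det_one_add_smul]
  rw [LinearMap.trace_eq_matrix_trace ℝ b]
  have h2 : HasDerivAt (fun t : ℝ => 1 + A.trace * t + P.eval t * t ^ 2)
      (0 + A.trace * 1 + (P.derivative.eval 0 * 0 ^ 2 + P.eval 0 * (2 * 0 ^ (2 - 1) * 1))) 0 :=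
    ((hasDerivAt_const _ _).add ((hasDerivAt_id (0 : ℝ)).const_mul _)).add
      ((P.hasDerivAt 0).mul ((hasDerivAt_id (0 : ℝ)).pow 2))
  simp only [hP]
  convert h2 using 1
  simp [A]

end ContinuousLinearMap

theorem contDiff_continuous_gradient {F : Type*} [NormedAddCommGroup F] [InnerProductSpace ℝ F]
    [CompleteSpace F] {f : F → ℝ} (hf : ContDiff ℝ 1 f) : Continuous (gradient f) :=
  (InnerProductSpace.toDual ℝ F).symm.continuous.comp (hf.continuous_fderiv one_ne_zero)

theorem inner_gradient_eq_fderiv {F : Type*} [NormedAddCommGroup F] [InnerProductSpace ℝ F]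
    [CompleteSpace F] (f : F → ℝ) (x v : F) : ⟪gradient f x, v⟫ = fderiv ℝ f x v := by
  rw [gradient, InnerProductSpace.toDual_symm_apply]

theorem norm_gradient_eq_norm_fderiv {F : Type*} [NormedAddCommGroup F] [InnerProductSpace ℝ F]
    [CompleteSpace F] (f : F → ℝ) (x : F) : ‖gradient f x‖ = ‖fderiv ℝ f x‖ := by
  rw [gradient, LinearIsometryEquiv.norm_map]

theorem continuous_norm_rpow_sub_two_smul {F : Type*} [NormedAddCommGroup F]
    [InnerProductSpace ℝ F] [CompleteSpace F] {p : ℝ} (hp : 1 < p) :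
    Continuous (fun v : F => ‖v‖ ^ (p - 2) • v) := by
  have h : (fun v : F => ‖v‖ ^ (p - 2) • v) =
      fun v => p⁻¹ • gradient (fun x : F => ‖x‖ ^ p) v := by
    ext1 v
    have : gradient (fun x : F => ‖x‖ ^ p) v = (p * ‖v‖ ^ (p - 2)) • v := by
      apply ext_inner_right ℝ
      intro w
      rw [inner_gradient_eq_fderiv, (hasFDerivAt_norm_rpow v hp).fderiv]
      simp [inner_smul_left]
    rw [this, smul_smul, ← mul_assoc, inv_mul_cancel₀ (by linarith), one_mul]
  rw [h]
  exact (contDiff_continuous_gradient (contDiff_norm_rpow hp)).const_smul _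

theorem norm_rpow_sub_two_smul {F : Type*} [NormedAddCommGroup F] [NormedSpace ℝ F] {p : ℝ}
    (hp : 1 < p) (v : F) : ‖‖v‖ ^ (p - 2) • v‖ = ‖v‖ ^ (p - 1) := by
  rw [norm_smul, Real.norm_of_nonneg (by positivity)]
  rcases eq_or_ne v 0 with rfl | hv
  · simp [Real.zero_rpow (by linarith : p - 1 ≠ 0)]
  · rw [← Real.rpow_add_one (norm_ne_zero_iff.2 hv)]
    congr 1; ring

/-- Differentiation under the integral sign of `G (t, a x)`, where `G` is `C¹` and the parameter
`a` is continuous up to the boundary of a bounded open set. -/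
theorem hasDerivAt_integral_of_contDiffOn {X P : Type*} [TopologicalSpace X] [MeasurableSpace X]
    [OpensMeasurableSpace X] [NormedAddCommGroup P] [NormedSpace ℝ P]
    {μ : Measure X} [IsFiniteMeasureOnCompacts μ] [SecondCountableTopology X]
    {U : Set X} (hU : IsOpen U) (hUc : IsCompact (closure U))
    {a : X → P} (ha : ContinuousOn a (closure U)) {G : ℝ × P → ℝ} {O : Set (ℝ × P)}
    (hO : IsOpen O) (hG : ContDiffOn ℝ 1 G O) (haO : ∀ x ∈ closure U, (0, a x) ∈ O)
    {g : X → ℝ} (hg : ∀ x ∈ U, HasDerivAt (fun t => G (t, a x)) (g x) 0) :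
    HasDerivAt (fun t => ∫ x in U, G (t, a x) ∂μ) (∫ x in U, g x ∂μ) 0 := by
  have hK : IsCompact (a '' closure U) := hUc.image_of_continuousOn ha
  obtain ⟨u, v, hu, hv, h0u, hKv, huv⟩ := generalized_tube_lemma
    (isCompact_singleton (x := (0 : ℝ))) hK hO (by
      rintro ⟨t, b⟩ ⟨ht, x, hx, rfl⟩
      obtain rfl : t = 0 := ht
      exact haO x hx)
  obtain ⟨ε, hε, hεu⟩ := Metric.nhds_basis_closedBall.mem_iff.1 (hu.mem_nhds (h0u rfl))
  have hmem : ∀ t ∈ closedBall (0 : ℝ) ε, ∀ x ∈ closure U, (t, a x) ∈ O := fun t ht x hx =>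
    huv ⟨hεu ht, hKv (mem_image_of_mem a hx)⟩
  have hG' : ContinuousOn (fun z : ℝ × P => fderiv ℝ G z (1, 0)) O :=
    (hG.continuousOn_fderiv_of_isOpen hO le_rfl).clm_apply continuousOn_const
  obtain ⟨C, hC⟩ := ((isCompact_closedBall (0 : ℝ) ε).prod hK).exists_bound_of_continuousOn
    (hG'.mono fun z hz => by
      obtain ⟨ht, x, hx, hxz⟩ := hz
      have := hmem z.1 ht x hx
      rwa [hxz] at this)
  have hder : ∀ t ∈ closedBall (0 : ℝ) ε, ∀ x ∈ closure U,
      HasDerivAt (fun t => G (t, a x)) (fderiv ℝ G (t, a x) (1, 0)) t := fun t ht x hx => by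
    have h1 := (hG.differentiableOn one_ne_zero).differentiableAt (hO.mem_nhds (hmem t ht x hx))
    exact h1.hasFDerivAt.comp_hasDerivAt t ((hasDerivAt_id t).prodMk (hasDerivAt_const t (a x)))
  have hcont : ∀ t ∈ closedBall (0 : ℝ) ε, ∀ {H : ℝ × P → ℝ}, ContinuousOn H O →
      ContinuousOn (fun x => H (t, a x)) (closure U) := fun t ht H hH =>
    hH.comp (continuousOn_const.prodMk ha) fun x hx => hmem t ht x hx
  have hμ : IsFiniteMeasure (μ.restrict U) :=
    ⟨by simpa using (measure_mono subset_closure).trans_lt hUc.measure_lt_top⟩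
  have h0 : (0 : ℝ) ∈ closedBall (0 : ℝ) ε := mem_closedBall_self hε.le
  have key := hasDerivAt_integral_of_dominated_loc_of_deriv_le (μ := μ.restrict U)
    (F := fun t x => G (t, a x)) (F' := fun t x => fderiv ℝ G (t, a x) (1, 0)) (x₀ := (0 : ℝ))
    (bound := fun _ => C) (closedBall_mem_nhds (0 : ℝ) hε) ?_ ?_ ?_ ?_ (integrable_const C) ?_
  · have heq : ∫ x in U, g x ∂μ = ∫ x in U, fderiv ℝ G (0, a x) (1, 0) ∂μ :=
      setIntegral_congr_fun hU.measurableSet fun x hx =>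
        (hg x hx).unique (hder 0 h0 x (subset_closure hx))
    rw [heq]
    exact key.2
  · filter_upwards [closedBall_mem_nhds (0 : ℝ) hε] with t ht
    exact ((hcont t ht hG.continuousOn).mono subset_closure).aestronglyMeasurable hU.measurableSet
  · obtain ⟨D, hD⟩ := hUc.exists_bound_of_continuousOn (hcont 0 h0 hG.continuousOn)
    refine Integrable.of_bound (((hcont 0 h0 hG.continuousOn).mono
      subset_closure).aestronglyMeasurable hU.measurableSet) D ?_
    exact (ae_restrict_mem hU.measurableSet).mono fun x hx => hD x (subset_closure hx)
  · exact ((hcont 0 h0 hG').mono subset_closure).aestronglyMeasurable hU.measurableSet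
  · refine (ae_restrict_mem hU.measurableSet).mono fun x hx t ht => ?_
    exact hC (t, a x) ⟨ht, mem_image_of_mem a (subset_closure hx)⟩
  · refine (ae_restrict_mem hU.measurableSet).mono fun x hx t ht => ?_
    exact hder t ht x (subset_closure hx)

theorem HasDerivAt.of_le_of_le {l s u : ℝ → ℝ} {l' u' a : ℝ} (hl : HasDerivAt l l' a)
    (hu : HasDerivAt u u' a) (hls : ∀ᶠ t in 𝓝 a, l t ≤ s t) (hsu : ∀ᶠ t in 𝓝 a, s t ≤ u t)
    (h : u a ≤ l a) : HasDerivAt s l' a := by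
  have hmin : IsLocalMin (fun t => u t - l t) a := by
    filter_upwards [hls, hsu] with t h1 h2
    linarith [hls.self_of_nhds, hsu.self_of_nhds]
  have hul : u' - l' = 0 := hmin.hasDerivAt_eq_zero (hu.sub hl)
  obtain rfl : u' = l' := by linarith
  have hl1 := (hasDerivAt_iff_isLittleO.1 hl).norm_left
  have hu1 := (hasDerivAt_iff_isLittleO.1 hu).norm_left
  rw [hasDerivAt_iff_isLittleO]
  refine Asymptotics.IsBigO.trans_isLittleO (Asymptotics.IsBigO.of_bound 1 ?_) (hl1.add hu1)
  filter_upwards [hls, hsu] with t h1 h2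
  have hs1 := hls.self_of_nhds
  have hs2 := hsu.self_of_nhds
  simp only [Real.norm_eq_abs, smul_eq_mul, one_mul]
  rw [abs_of_nonneg (by positivity : 0 ≤ |l t - l a - (t - a) * u'| + |u t - u a - (t - a) * u'|),
    abs_le]
  constructor
  · linarith [neg_abs_le (l t - l a - (t - a) * u'), abs_nonneg (u t - u a - (t - a) * u')]
  · linarith [le_abs_self (u t - u a - (t - a) * u'), abs_nonneg (l t - l a - (t - a) * u')]

theorem tendsto_setIntegral_of_continuousOn_of_bounded {X : Type*} [TopologicalSpace X]
    [MeasurableSpace X] [OpensMeasurableSpace X] [SecondCountableTopology X] {μ : Measure X}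
    {U : Set X} (hU : MeasurableSet U) (hμ : μ U < ⊤) {F : ℕ → X → ℝ} {f : X → ℝ} {C : ℝ}
    (hF : ∀ n, ContinuousOn (F n) U) (hC : ∀ n, ∀ x ∈ U, ‖F n x‖ ≤ C)
    (hlim : ∀ x ∈ U, Tendsto (fun n => F n x) atTop (𝓝 (f x))) :
    Tendsto (fun n => ∫ x in U, F n x ∂μ) atTop (𝓝 (∫ x in U, f x ∂μ)) := by
  have : IsFiniteMeasure (μ.restrict U) := ⟨by simpa using hμ⟩
  refine tendsto_integral_of_dominated_convergence (fun _ => C)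
    (fun n => (hF n).aestronglyMeasurable hU) (integrable_const C)
    (fun n => (ae_restrict_mem hU).mono fun x hx => hC n x hx)
    ((ae_restrict_mem hU).mono fun x hx => hlim x hx)

theorem integrableOn_of_continuousOn_closure {X : Type*} [TopologicalSpace X]
    [MeasurableSpace X] [OpensMeasurableSpace X] [SecondCountableTopology X] {μ : Measure X}
    [IsFiniteMeasureOnCompacts μ] {U : Set X} (hU : MeasurableSet U) (hUc : IsCompact (closure U))
    {f : X → ℝ} (hf : ContinuousOn f (closure U)) : IntegrableOn f U μ := by
  obtain ⟨D, hD⟩ := hUc.exists_bound_of_continuousOn hf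
  have : IsFiniteMeasure (μ.restrict U) :=
    ⟨by simpa using (measure_mono subset_closure).trans_lt hUc.measure_lt_top⟩
  exact Integrable.of_bound ((hf.mono subset_closure).aestronglyMeasurable hU) D
    ((ae_restrict_mem hU).mono fun x hx => hD x (subset_closure hx))

section Mollification

variable {N : ℕ} {U : Set (EuclideanSpace ℝ (Fin N))} {ψ : EuclideanSpace ℝ (Fin N) → ℝ}

theorem exists_isTestFun_approx (hU : IsOpen U) (hψ : ContDiff ℝ 1 ψ)
    (hψc : HasCompactSupport ψ) (hψU : tsupport ψ ⊆ U) {ε : ℝ} (hε : 0 < ε) :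
    ∃ φ, IsTestFun U φ ∧ (∀ x, dist (φ x) (ψ x) ≤ ε) ∧
      ∀ x, dist (gradient φ x) (gradient ψ x) ≤ ε := by
  obtain ⟨δ₁, hδ₁, h₁⟩ := Metric.uniformContinuous_iff.1
    (hψc.uniformContinuous_of_continuous hψ.continuous) ε hε
  obtain ⟨δ₂, hδ₂, h₂⟩ := Metric.uniformContinuous_iff.1
    ((hψc.fderiv ℝ).uniformContinuous_of_continuous (hψ.continuous_fderiv one_ne_zero)) ε hε
  obtain ⟨δ₃, hδ₃, h₃⟩ := IsCompact.exists_cthickening_subset_open hψc hU hψU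
  set δ := min δ₁ (min δ₂ δ₃) with hδdef
  have hδ : 0 < δ := lt_min hδ₁ (lt_min hδ₂ hδ₃)
  let b : ContDiffBump (0 : EuclideanSpace ℝ (Fin N)) := ⟨δ / 2, δ, half_pos hδ, half_lt_self hδ⟩
  let φ : EuclideanSpace ℝ (Fin N) → ℝ :=
    convolution (b.normed volume) ψ (ContinuousLinearMap.lsmul ℝ ℝ) volume
  have hφ : ∀ x (ε' : ℝ), (∀ z ∈ ball x δ, dist (ψ z) (ψ x) ≤ ε') → dist (φ x) (ψ x) ≤ ε' :=
    fun x ε' h => b.dist_normed_convolution_le hψ.continuous.aestronglyMeasurable h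
  have hφ' : ∀ x (ε' : ℝ), (∀ z ∈ ball x δ, dist (fderiv ℝ ψ z) (fderiv ℝ ψ x) ≤ ε') →
      dist (fderiv ℝ φ x) (fderiv ℝ ψ x) ≤ ε' := fun x ε' h => by
    have h4 : fderiv ℝ φ x = convolution (b.normed volume) (fderiv ℝ ψ)
        (ContinuousLinearMap.lsmul ℝ ℝ) volume x :=
      (hψc.hasFDerivAt_convolution_right (ContinuousLinearMap.lsmul ℝ ℝ)
        (b.continuous_normed.locallyIntegrable) hψ x).fderiv
    rw [h4]
    exact b.dist_normed_convolution_le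
      (hψ.continuous_fderiv one_ne_zero).aestronglyMeasurable h
  have hsupp : Function.support φ ⊆ cthickening δ₃ (tsupport ψ) := by
    intro x hx
    by_contra hxn
    have hz : ∀ z ∈ closedBall x δ₃, ψ z = 0 := fun z hz => by
      refine image_eq_zero_of_notMem_tsupport fun hzs => hxn ?_
      exact mem_cthickening_of_dist_le x z δ₃ _ hzs (by rwa [dist_comm])
    have hx0 : ψ x = 0 := hz x (mem_closedBall_self hδ₃.le)
    have := hφ x 0 fun z hzb => by
      rw [hx0, hz z (ball_subset_closedBall (ball_subset_ball
        ((min_le_right _ _).trans (min_le_right _ _)) hzb)), dist_self]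
    rw [hx0] at this
    exact hx (dist_le_zero.1 this)
  have hts : tsupport φ ⊆ cthickening δ₃ (tsupport ψ) :=
    closure_minimal hsupp isClosed_cthickening
  refine ⟨φ, ⟨?_, ?_, hts.trans h₃⟩, fun x => hφ x ε fun z hz => ?_, fun x => ?_⟩
  · exact b.hasCompactSupport_normed.contDiff_convolution_left _ b.contDiff_normed
      hψ.continuous.locallyIntegrable
  · exact (IsCompact.cthickening hψc).of_isClosed_subset (isClosed_tsupport φ) hts
  · exact (h₁ (lt_of_lt_of_le hz (min_le_left _ _))).le
  · rw [gradient, gradient, LinearIsometryEquiv.dist_map]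
    exact hφ' x ε fun z hz =>
      (h₂ (lt_of_lt_of_le hz ((min_le_right _ _).trans (min_le_left _ _)))).le

theorem exists_seq_isTestFun_tendsto (hU : IsOpen U) (hψ : ContDiff ℝ 1 ψ)
    (hψc : HasCompactSupport ψ) (hψU : tsupport ψ ⊆ U) :
    ∃ (φ : ℕ → EuclideanSpace ℝ (Fin N) → ℝ) (C : ℝ), (∀ n, IsTestFun U (φ n)) ∧
      (∀ x, Tendsto (fun n => φ n x) atTop (𝓝 (ψ x))) ∧
      (∀ x, Tendsto (fun n => gradient (φ n) x) atTop (𝓝 (gradient ψ x))) ∧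
      (∀ n x, ‖φ n x‖ ≤ C) ∧ ∀ n x, ‖gradient (φ n) x‖ ≤ C := by
  have h := fun n : ℕ =>
    exists_isTestFun_approx hU hψ hψc hψU (ε := 1 / ((n : ℝ) + 1)) Nat.one_div_pos_of_nat
  choose φ hφ h0 h1 using h
  obtain ⟨C₀, hC₀⟩ := hψc.exists_bound_of_continuous hψ.continuous
  obtain ⟨C₁, hC₁⟩ := (hψc.fderiv ℝ).exists_bound_of_continuous (hψ.continuous_fderiv one_ne_zero)
  have hle : ∀ n : ℕ, 1 / ((n : ℝ) + 1) ≤ 1 := fun n => by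
    rw [div_le_one (by positivity)]
    linarith [n.cast_nonneg (α := ℝ)]
  refine ⟨φ, max C₀ C₁ + 1, hφ, fun x => ?_, fun x => ?_, fun n x => ?_, fun n x => ?_⟩
  · exact tendsto_iff_dist_tendsto_zero.2 (squeeze_zero (fun _ => dist_nonneg) (fun n => h0 n x)
      tendsto_one_div_add_atTop_nhds_zero_nat)
  · exact tendsto_iff_dist_tendsto_zero.2 (squeeze_zero (fun _ => dist_nonneg) (fun n => h1 n x)
      tendsto_one_div_add_atTop_nhds_zero_nat)
  · have := (norm_le_norm_add_norm_sub' (φ n x) (ψ x))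
    rw [← dist_eq_norm] at this
    linarith [h0 n x, hle n, hC₀ x, le_max_left C₀ C₁]
  · have := (norm_le_norm_add_norm_sub' (gradient (φ n) x) (gradient ψ x))
    rw [← dist_eq_norm, norm_gradient_eq_norm_fderiv ψ] at this
    linarith [h1 n x, hle n, hC₁ x, le_max_right C₀ C₁]

end Mollification

/-- The functional whose supremum over test functions defines the `p`-torsional rigidity. -/
def torsionEnergy (p : ℝ) {N : ℕ} (U : Set (EuclideanSpace ℝ (Fin N)))
    (φ : EuclideanSpace ℝ (Fin N) → ℝ) : ℝ :=
  (∫ x in U, φ x) - (1 / p) * ∫ x in U, ‖gradient φ x‖ ^ p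

/-- The supremum in the definition of the `p`-torsional rigidity. -/
def torsionSup (p : ℝ) {N : ℕ} (U : Set (EuclideanSpace ℝ (Fin N))) : ℝ :=
  sSup { r : ℝ | ∃ φ, IsTestFun U φ ∧ r = torsionEnergy p U φ }

section C1Tests

variable {N : ℕ} {U : Set (EuclideanSpace ℝ (Fin N))} {ψ : EuclideanSpace ℝ (Fin N) → ℝ}

theorem IsTestFun.contDiff_one (h : IsTestFun U ψ) : ContDiff ℝ 1 ψ :=
  h.1.of_le (by exact_mod_cast le_top)

theorem torsionEnergy_le_of_forall_isTestFun {p : ℝ} (hp : 0 < p) (hU : IsOpen U)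
    (hUμ : volume U < ⊤) (hψ : ContDiff ℝ 1 ψ) (hψc : HasCompactSupport ψ) (hψU : tsupport ψ ⊆ U)
    {M : ℝ} (hM : ∀ φ, IsTestFun U φ → torsionEnergy p U φ ≤ M) : torsionEnergy p U ψ ≤ M := by
  obtain ⟨φ, C, hφ, h0, h1, hC0, hC1⟩ := exists_seq_isTestFun_tendsto hU hψ hψc hψU
  have hlim : Tendsto (fun n => torsionEnergy p U (φ n)) atTop (𝓝 (torsionEnergy p U ψ)) := by
    refine Tendsto.sub ?_ (Tendsto.const_mul _ ?_)
    · exact tendsto_setIntegral_of_continuousOn_of_bounded hU.measurableSet hUμ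
        (fun n => (hφ n).1.continuous.continuousOn) (fun n x _ => hC0 n x) fun x _ => h0 x
    · refine tendsto_setIntegral_of_continuousOn_of_bounded (C := C ^ p) hU.measurableSet hUμ
        (fun n => ?_) (fun n x _ => ?_) fun x _ => ?_
      · exact ((contDiff_continuous_gradient (hφ n).contDiff_one).norm.rpow_const
          fun x => Or.inr hp.le).continuousOn
      · rw [Real.norm_of_nonneg (by positivity)]
        exact Real.rpow_le_rpow (norm_nonneg _) (hC1 n x) hp.le
      · exact ((h1 x).norm).rpow_const (Or.inr hp.le)
  exact le_of_tendsto' hlim fun n => hM _ (hφ n)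

theorem IsWeakSolution.setIntegral_eq_of_contDiff_one {p : ℝ} (hp : 1 < p) (hU : IsOpen U)
    (hUc : IsCompact (closure U)) {y : EuclideanSpace ℝ (Fin N) → ℝ}
    (hy : ContinuousOn (gradient y) (closure U)) (hsol : IsWeakSolution p U y (fun _ => 1))
    (hψ : ContDiff ℝ 1 ψ) (hψc : HasCompactSupport ψ) (hψU : tsupport ψ ⊆ U) :
    ∫ x in U, ⟪‖gradient y x‖ ^ (p - 2) • gradient y x, gradient ψ x⟫ = ∫ x in U, ψ x := by
  obtain ⟨φ, C, hφ, h0, h1, hC0, hC1⟩ := exists_seq_isTestFun_tendsto hU hψ hψc hψU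
  have hUμ : volume U < ⊤ := (measure_mono subset_closure).trans_lt hUc.measure_lt_top
  have hσ : ContinuousOn (fun x => ‖gradient y x‖ ^ (p - 2) • gradient y x) (closure U) :=
    (continuous_norm_rpow_sub_two_smul hp).comp_continuousOn hy
  obtain ⟨D, hD⟩ := hUc.exists_bound_of_continuousOn hσ
  refine tendsto_nhds_unique (f := fun n => ∫ x in U, φ n x) (l := atTop) ?_ ?_
  · have : ∀ n, ∫ x in U, φ n x =
        ∫ x in U, ⟪‖gradient y x‖ ^ (p - 2) • gradient y x, gradient (φ n) x⟫ := fun n => by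
      have := hsol (φ n) (hφ n)
      simp only [one_mul] at this
      simp only [real_inner_smul_left, this]
    simp only [this]
    refine tendsto_setIntegral_of_continuousOn_of_bounded (C := D * C) hU.measurableSet hUμ
        (fun n => ?_) (fun n x hx => ?_) fun x _ => ?_
    · exact (hσ.mono subset_closure).inner
        (contDiff_continuous_gradient (hφ n).contDiff_one).continuousOn
    · exact (norm_inner_le_norm _ _).trans (mul_le_mul (hD x (subset_closure hx)) (hC1 n x)
        (norm_nonneg _) ((norm_nonneg _).trans (hD x (subset_closure hx))))
    · exact tendsto_const_nhds.inner (h1 x)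
  · exact tendsto_setIntegral_of_continuousOn_of_bounded hU.measurableSet hUμ
        (fun n => (hφ n).1.continuous.continuousOn) (fun n x _ => hC0 n x) fun x _ => h0 x

end C1Tests

/-- A `C¹` nondecreasing function that vanishes on `(-∞, δ]` and has slope one on `[2δ, ∞)`. -/
def softThreshold (δ s : ℝ) : ℝ := ∫ r in (0 : ℝ)..s, Real.smoothTransition (r / δ - 1)

section SoftThreshold

variable {δ s : ℝ}

theorem continuous_smoothTransition_div_sub_one (δ : ℝ) :
    Continuous fun r => Real.smoothTransition (r / δ - 1) :=
  Real.smoothTransition.continuous.comp ((continuous_id.div_const δ).sub continuous_const)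

theorem hasDerivAt_softThreshold (δ s : ℝ) :
    HasDerivAt (softThreshold δ) (Real.smoothTransition (s / δ - 1)) s :=
  (continuous_smoothTransition_div_sub_one δ).integral_hasStrictDerivAt 0 s |>.hasDerivAt

theorem deriv_softThreshold (δ : ℝ) :
    deriv (softThreshold δ) = fun s => Real.smoothTransition (s / δ - 1) :=
  funext fun s => (hasDerivAt_softThreshold δ s).deriv

theorem contDiff_softThreshold (δ : ℝ) : ContDiff ℝ 1 (softThreshold δ) := by
  refine contDiff_one_iff_deriv.2 ⟨fun s => (hasDerivAt_softThreshold δ s).differentiableAt, ?_⟩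
  rw [deriv_softThreshold]
  exact continuous_smoothTransition_div_sub_one δ

theorem monotone_softThreshold (δ : ℝ) : Monotone (softThreshold δ) :=
  monotone_of_deriv_nonneg (fun s => (hasDerivAt_softThreshold δ s).differentiableAt) fun s => by
    rw [deriv_softThreshold]
    exact Real.smoothTransition.nonneg _

theorem softThreshold_eq_zero (hδ : 0 < δ) (hs : s ≤ δ) : softThreshold δ s = 0 := by
  refine intervalIntegral.integral_zero_ae (Eventually.of_forall fun r hr => ?_)
  refine Real.smoothTransition.zero_of_nonpos ?_
  rw [sub_nonpos, div_le_one hδ]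
  rcases le_total 0 s with h | h
  · rw [uIoc_of_le h] at hr
    exact hr.2.trans hs
  · rw [uIoc_of_ge h] at hr
    exact hr.2.trans hδ.le

theorem softThreshold_nonneg (hδ : 0 < δ) (s : ℝ) : 0 ≤ softThreshold δ s := by
  rcases le_total s δ with h | h
  · exact (softThreshold_eq_zero hδ h).ge
  · rw [← softThreshold_eq_zero hδ le_rfl]
    exact monotone_softThreshold δ h

theorem softThreshold_le (δ : ℝ) (hs : 0 ≤ s) : softThreshold δ s ≤ s := by
  have h := intervalIntegral.integral_mono_on (μ := volume) hs
    ((continuous_smoothTransition_div_sub_one δ).intervalIntegrable 0 s)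
    (continuous_const (y := (1 : ℝ)).intervalIntegrable 0 s)
    fun r _ => Real.smoothTransition.le_one (r / δ - 1)
  simpa [softThreshold] using h

theorem sub_le_softThreshold (hδ : 0 < δ) (s : ℝ) : s - 2 * δ ≤ softThreshold δ s := by
  rcases le_total s (2 * δ) with h | h
  · linarith [softThreshold_nonneg hδ s]
  · have h1 : softThreshold δ s = softThreshold δ (2 * δ) +
        ∫ r in (2 * δ)..s, Real.smoothTransition (r / δ - 1) :=
      (intervalIntegral.integral_add_adjacent_intervals
        ((continuous_smoothTransition_div_sub_one δ).intervalIntegrable _ _)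
        ((continuous_smoothTransition_div_sub_one δ).intervalIntegrable _ _)).symm
    have h2 : ∫ r in (2 * δ)..s, Real.smoothTransition (r / δ - 1) = ∫ r in (2 * δ)..s, (1 : ℝ) :=
      intervalIntegral.integral_congr fun r hr => by
        rw [uIcc_of_le h] at hr
        refine Real.smoothTransition.one_of_one_le ?_
        rw [le_sub_iff_add_le, le_div_iff₀ hδ]
        linarith [hr.1]
    rw [h1, h2]
    simp [softThreshold_nonneg hδ]

theorem tendsto_softThreshold (hs : 0 ≤ s) :
    Tendsto (fun n : ℕ => softThreshold (1 / ((n : ℝ) + 1)) s) atTop (𝓝 s) := by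
  have h : Tendsto (fun n : ℕ => s - 2 * (1 / ((n : ℝ) + 1))) atTop (𝓝 (s - 2 * 0)) :=
    tendsto_const_nhds.sub (tendsto_one_div_add_atTop_nhds_zero_nat.const_mul 2)
  rw [mul_zero, sub_zero] at h
  exact tendsto_of_tendsto_of_tendsto_of_le_of_le h tendsto_const_nhds
    (fun n => sub_le_softThreshold Nat.one_div_pos_of_nat s) fun n => softThreshold_le _ hs

theorem tendsto_deriv_softThreshold (hs : 0 < s) :
    Tendsto (fun n : ℕ => deriv (softThreshold (1 / ((n : ℝ) + 1))) s) atTop (𝓝 1) := by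
  refine tendsto_const_nhds.congr' ?_
  have h := (tendsto_one_div_add_atTop_nhds_zero_nat (𝕜 := ℝ)).eventually
    (gt_mem_nhds (half_pos hs))
  filter_upwards [h] with n hn
  rw [deriv_softThreshold]
  refine (Real.smoothTransition.one_of_one_le ?_).symm
  rw [le_sub_iff_add_le, le_div_iff₀ Nat.one_div_pos_of_nat]
  linarith

end SoftThreshold

section Truncation

variable {N : ℕ} {Ω : Set (EuclideanSpace ℝ (Fin N))} {y : EuclideanSpace ℝ (Fin N) → ℝ}

theorem C1OnClosure.neg (hy : C1OnClosure Ω y) : C1OnClosure Ω (fun x => -y x) := by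
  obtain ⟨W, hW, hΩW, h⟩ := hy
  exact ⟨W, hW, hΩW, h.neg⟩

theorem C1OnClosure.contDiffAt (hy : C1OnClosure Ω y) {x : EuclideanSpace ℝ (Fin N)}
    (hx : x ∈ closure Ω) : ContDiffAt ℝ 1 y x := by
  obtain ⟨W, hW, hΩW, h⟩ := hy
  exact h.contDiffAt (hW.mem_nhds (hΩW hx))

theorem C1OnClosure.continuousOn (hy : C1OnClosure Ω y) : ContinuousOn y (closure Ω) :=
  fun _ hx => (hy.contDiffAt hx).continuousAt.continuousWithinAt

theorem C1OnClosure.continuousOn_gradient (hy : C1OnClosure Ω y) :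
    ContinuousOn (gradient y) (closure Ω) := by
  obtain ⟨W, hW, hΩW, h⟩ := hy
  exact (InnerProductSpace.toDual ℝ _).symm.continuous.comp_continuousOn
    ((h.continuousOn_fderiv_of_isOpen hW le_rfl).mono hΩW)

theorem C1OnClosure.indicator_comp (hΩo : IsOpen Ω) (hΩc : IsCompact (closure Ω))
    (hy : C1OnClosure Ω y) (hy0 : ∀ x ∈ frontier Ω, y x = 0) {T : ℝ → ℝ} (hT : ContDiff ℝ 1 T)
    {δ : ℝ} (hδ : 0 < δ) (hTδ : ∀ s ≤ δ, T s = 0) :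
    ContDiff ℝ 1 (Ω.indicator fun x => T (y x)) ∧
      HasCompactSupport (Ω.indicator fun x => T (y x)) ∧
      tsupport (Ω.indicator fun x => T (y x)) ⊆ Ω ∧
      ∀ x ∈ Ω, gradient (Ω.indicator fun x => T (y x)) x = deriv T (y x) • gradient y x := by
  set ψ := Ω.indicator fun x => T (y x)
  have hK : IsClosed (closure Ω ∩ y ⁻¹' Ici δ) :=
    hy.continuousOn.preimage_isClosed_of_isClosed isClosed_closure isClosed_Ici
  have hKΩ : closure Ω ∩ y ⁻¹' Ici δ ⊆ Ω := by
    rintro x ⟨hx, hxδ⟩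
    by_contra hxΩ
    have : x ∈ frontier Ω := ⟨hx, by rwa [hΩo.interior_eq]⟩
    have h1 : δ ≤ y x := hxδ
    rw [hy0 x this] at h1
    exact absurd h1 (not_le.2 hδ)
  have hsupp : tsupport ψ ⊆ closure Ω ∩ y ⁻¹' Ici δ := by
    refine closure_minimal (fun x hx => ?_) hK
    have hxΩ : x ∈ Ω := mem_of_indicator_ne_zero hx
    refine ⟨subset_closure hxΩ, ?_⟩
    by_contra hlt
    refine hx ?_
    simp only [ψ, indicator_of_mem hxΩ]
    exact hTδ _ (not_le.1 hlt).le
  have heq : ∀ x ∈ Ω, ψ =ᶠ[𝓝 x] fun z => T (y z) := fun x hx => by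
    filter_upwards [hΩo.mem_nhds hx] with z hz
    exact indicator_of_mem hz _
  refine ⟨contDiff_iff_contDiffAt.2 fun x => ?_, ?_, hsupp.trans hKΩ, fun x hx => ?_⟩
  · by_cases hx : x ∈ Ω
    · exact (hT.contDiffAt.comp x (hy.contDiffAt (subset_closure hx))).congr_of_eventuallyEq
        (heq x hx)
    · have : ψ =ᶠ[𝓝 x] fun _ => 0 := by
        filter_upwards [(isClosed_tsupport ψ).isOpen_compl.mem_nhds
          fun h => hx (hKΩ (hsupp h))] with z hz
        exact image_eq_zero_of_notMem_tsupport hz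
      exact contDiffAt_const.congr_of_eventuallyEq this
  · exact hΩc.of_isClosed_subset (isClosed_tsupport ψ) (hsupp.trans inter_subset_left)
  · have hyx := (hy.contDiffAt (subset_closure hx)).differentiableAt one_ne_zero
    have h1 : HasFDerivAt ψ (deriv T (y x) • fderiv ℝ y x) x :=
      ((((hT.differentiable one_ne_zero) (y x)).hasDerivAt).comp_hasFDerivAt x
        hyx.hasFDerivAt).congr_of_eventuallyEq (heq x hx)
    rw [gradient, h1.fderiv, map_smul, gradient]

theorem rpow_sub_two_mul_norm_sq {F : Type*} [NormedAddCommGroup F] {p : ℝ} (hp : 1 < p) (v : F) :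
    ‖v‖ ^ (p - 2) * ‖v‖ ^ 2 = ‖v‖ ^ p := by
  rcases eq_or_ne v 0 with rfl | hv
  · simp [Real.zero_rpow (by linarith : p ≠ 0)]
  · rw [← Real.rpow_natCast, ← Real.rpow_add (norm_pos_iff.2 hv)]
    congr 1
    push_cast
    ring

theorem IsWeakSolution.nonneg {p : ℝ} (hp : 1 < p) (hΩo : IsOpen Ω)
    (hΩc : IsCompact (closure Ω)) (hy : C1OnClosure Ω y) (hy0 : ∀ x ∈ frontier Ω, y x = 0)
    (hsol : IsWeakSolution p Ω y (fun _ => 1)) {x : EuclideanSpace ℝ (Fin N)} (hx : x ∈ Ω) :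
    0 ≤ y x := by
  by_contra hlt
  rw [not_le] at hlt
  set δ := -y x / 3 with hδdef
  have hδ : 0 < δ := by rw [hδdef]; linarith
  obtain ⟨hψ, hψc, hψΩ, hgrad⟩ := C1OnClosure.indicator_comp hΩo hΩc hy.neg
    (fun x hx => by simp [hy0 x hx]) (contDiff_softThreshold δ) hδ
    fun s hs => softThreshold_eq_zero hδ hs
  set ψ := Ω.indicator fun x => softThreshold δ (-y x)
  have hneg : ∀ z, gradient (fun x => -y x) z = -gradient y z := fun z => by
    rw [gradient, fderiv_fun_neg, map_neg, gradient]
  have h := hsol.setIntegral_eq_of_contDiff_one hp hΩo hΩc hy.continuousOn_gradient hψ hψc hψΩ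
  have hle : ∫ z in Ω, ⟪‖gradient y z‖ ^ (p - 2) • gradient y z, gradient ψ z⟫ ≤ 0 := by
    refine setIntegral_nonpos hΩo.measurableSet fun z hz => ?_
    rw [hgrad z hz, hneg, real_inner_smul_left, real_inner_smul_right, inner_neg_right,
      real_inner_self_eq_norm_sq, deriv_softThreshold]
    have h1 := Real.smoothTransition.nonneg (-y z / δ - 1)
    have h2 : 0 ≤ ‖gradient y z‖ ^ (p - 2) := by positivity
    nlinarith [mul_nonneg h2 (mul_nonneg h1 (sq_nonneg ‖gradient y z‖))]
  have hψ0 : ∀ z, 0 ≤ ψ z := fun z =>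
    indicator_nonneg (fun _ _ => softThreshold_nonneg hδ _) z
  have hψx : 0 < ψ x := by
    have h1 : ψ x = softThreshold δ (-y x) := indicator_of_mem hx _
    have h2 := sub_le_softThreshold hδ (-y x)
    rw [h1]
    linarith
  have hpos : 0 < ∫ z, ψ z := hψ.continuous.integral_pos_of_hasCompactSupport_nonneg_nonzero hψc
    hψ0 hψx.ne'
  have hint : ∫ z in Ω, ψ z = ∫ z, ψ z :=
    setIntegral_eq_integral_of_forall_compl_eq_zero fun z hz => indicator_of_notMem hz _
  linarith

theorem IsWeakSolution.gradient_eq_zero {p : ℝ} (hp : 1 < p) (hΩo : IsOpen Ω)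
    (hΩc : IsCompact (closure Ω)) (hy : C1OnClosure Ω y) (hy0 : ∀ x ∈ frontier Ω, y x = 0)
    (hsol : IsWeakSolution p Ω y (fun _ => 1)) {x : EuclideanSpace ℝ (Fin N)} (hx : x ∈ Ω)
    (hyx : y x = 0) : gradient y x = 0 := by
  have hmin : IsLocalMin y x := by
    filter_upwards [hΩo.mem_nhds hx] with z hz
    rw [hyx]
    exact hsol.nonneg hp hΩo hΩc hy hy0 hz
  rw [gradient, hmin.fderiv_eq_zero, map_zero]

/-- A torsion function is a limit of `C¹` functions compactly supported in the domain. -/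
theorem IsWeakSolution.exists_seq_tendsto {p : ℝ} (hp : 1 < p) (hΩo : IsOpen Ω)
    (hΩc : IsCompact (closure Ω)) (hy : C1OnClosure Ω y) (hy0 : ∀ x ∈ frontier Ω, y x = 0)
    (hsol : IsWeakSolution p Ω y (fun _ => 1)) :
    ∃ (ψ : ℕ → EuclideanSpace ℝ (Fin N) → ℝ) (C : ℝ),
      (∀ n, ContDiff ℝ 1 (ψ n) ∧ HasCompactSupport (ψ n) ∧ tsupport (ψ n) ⊆ Ω) ∧
      (∀ x ∈ Ω, Tendsto (fun n => ψ n x) atTop (𝓝 (y x))) ∧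
      (∀ x ∈ Ω, Tendsto (fun n => gradient (ψ n) x) atTop (𝓝 (gradient y x))) ∧
      (∀ n, ∀ x ∈ Ω, ‖ψ n x‖ ≤ C) ∧ ∀ n, ∀ x ∈ Ω, ‖gradient (ψ n) x‖ ≤ C := by
  obtain ⟨C₀, hC₀⟩ := hΩc.exists_bound_of_continuousOn hy.continuousOn
  obtain ⟨C₁, hC₁⟩ := hΩc.exists_bound_of_continuousOn hy.continuousOn_gradient
  have hδ : ∀ n : ℕ, 0 < 1 / ((n : ℝ) + 1) := fun n => Nat.one_div_pos_of_nat
  have htr := fun n : ℕ => hy.indicator_comp hΩo hΩc hy0 (contDiff_softThreshold _) (hδ n)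
    fun s hs => softThreshold_eq_zero (hδ n) hs
  have hnn : ∀ x ∈ Ω, 0 ≤ y x := fun x hx => hsol.nonneg hp hΩo hΩc hy hy0 hx
  refine ⟨fun n => Ω.indicator fun x => softThreshold (1 / ((n : ℝ) + 1)) (y x), max C₀ C₁,
    fun n => ⟨(htr n).1, (htr n).2.1, (htr n).2.2.1⟩, fun x hx => ?_, fun x hx => ?_,
    fun n x hx => ?_, fun n x hx => ?_⟩
  · simp only [indicator_of_mem hx]
    exact tendsto_softThreshold (hnn x hx)
  · simp only [fun n => (htr n).2.2.2 x hx]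
    rcases (hnn x hx).eq_or_lt with h | h
    · simp [hsol.gradient_eq_zero hp hΩo hΩc hy hy0 hx h.symm]
    · simpa using (tendsto_deriv_softThreshold h).smul_const (gradient y x)
  · simp only [indicator_of_mem hx]
    have h1 := hC₀ x (subset_closure hx)
    rw [Real.norm_of_nonneg (hnn x hx)] at h1
    rw [Real.norm_of_nonneg (softThreshold_nonneg (hδ n) _)]
    exact (softThreshold_le _ (hnn x hx)).trans (h1.trans (le_max_left _ _))
  · rw [(htr n).2.2.2 x hx, norm_smul, deriv_softThreshold,
      Real.norm_of_nonneg (Real.smoothTransition.nonneg _)]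
    exact (mul_le_of_le_one_left (norm_nonneg _) (Real.smoothTransition.le_one _)).trans
      ((hC₁ x (subset_closure hx)).trans (le_max_right _ _))

theorem IsWeakSolution.setIntegral_eq_norm_rpow {p : ℝ} (hp : 1 < p) (hΩo : IsOpen Ω)
    (hΩc : IsCompact (closure Ω)) (hy : C1OnClosure Ω y) (hy0 : ∀ x ∈ frontier Ω, y x = 0)
    (hsol : IsWeakSolution p Ω y (fun _ => 1)) :
    ∫ x in Ω, y x = ∫ x in Ω, ‖gradient y x‖ ^ p := by
  obtain ⟨ψ, C, hψ, h0, h1, hC0, hC1⟩ := hsol.exists_seq_tendsto hp hΩo hΩc hy hy0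
  have hΩμ : volume Ω < ⊤ := (measure_mono subset_closure).trans_lt hΩc.measure_lt_top
  have hσ : ContinuousOn (fun x => ‖gradient y x‖ ^ (p - 2) • gradient y x) (closure Ω) :=
    (continuous_norm_rpow_sub_two_smul hp).comp_continuousOn hy.continuousOn_gradient
  obtain ⟨D, hD⟩ := hΩc.exists_bound_of_continuousOn hσ
  refine tendsto_nhds_unique (f := fun n => ∫ x in Ω, ψ n x) (l := atTop) ?_ ?_
  · exact tendsto_setIntegral_of_continuousOn_of_bounded hΩo.measurableSet hΩμ
      (fun n => (hψ n).1.continuous.continuousOn) hC0 h0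
  · simp only [← fun n => hsol.setIntegral_eq_of_contDiff_one hp hΩo hΩc hy.continuousOn_gradient
      (hψ n).1 (hψ n).2.1 (hψ n).2.2]
    refine tendsto_setIntegral_of_continuousOn_of_bounded (C := D * C) hΩo.measurableSet hΩμ
        (fun n => ?_) (fun n x hx => ?_) fun x hx => ?_
    · exact (hσ.mono subset_closure).inner
        (contDiff_continuous_gradient (hψ n).1).continuousOn
    · exact (norm_inner_le_norm _ _).trans (mul_le_mul (hD x (subset_closure hx)) (hC1 n x hx)
        (norm_nonneg _) ((norm_nonneg _).trans (hD x (subset_closure hx))))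
    · have h2 := (tendsto_const_nhds (x := ‖gradient y x‖ ^ (p - 2) • gradient y x)).inner (𝕜 := ℝ)
        (h1 x hx)
      rwa [real_inner_smul_left _ (gradient y x), real_inner_self_eq_norm_sq,
        rpow_sub_two_mul_norm_sq hp] at h2

end Truncation

theorem eventually_exists_homeomorph_add_smul {N : ℕ}
    {V : EuclideanSpace ℝ (Fin N) → EuclideanSpace ℝ (Fin N)}
    (hV : ContDiff ℝ (⊤ : ℕ∞) V) (hVc : HasCompactSupport V) :
    ∀ᶠ t in 𝓝 (0 : ℝ), ∃ Φ : EuclideanSpace ℝ (Fin N) ≃ₜ EuclideanSpace ℝ (Fin N),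
      (⇑Φ = fun x => x + t • V x) ∧ ∀ x, IsUnit (1 + t • fderiv ℝ V x) := by
  obtain ⟨C, hC⟩ := ContDiff.lipschitzWith_of_hasCompactSupport hVc hV (by simp)
  have hlim : Tendsto (fun t : ℝ => ‖t‖₊ * C) (𝓝 0) (𝓝 0) := by
    have : Continuous fun t : ℝ => ‖t‖₊ * C := by fun_prop
    simpa using this.tendsto 0
  filter_upwards [hlim.eventually_lt_const zero_lt_one] with t ht
  have hlip : LipschitzWith (‖t‖₊ * C) fun x => t • V x := (lipschitzWith_smul t).comp hC
  have happ : ApproximatesLinearOn (fun x => x + t • V x)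
      ((ContinuousLinearEquiv.refl ℝ (EuclideanSpace ℝ (Fin N)) :
        EuclideanSpace ℝ (Fin N) →L[ℝ] EuclideanSpace ℝ (Fin N))) univ (‖t‖₊ * C) := by
    rw [ApproximatesLinearOn.approximatesLinearOn_iff_lipschitzOnWith]
    have hsub : (fun x => x + t • V x) - ⇑(ContinuousLinearEquiv.refl ℝ
        (EuclideanSpace ℝ (Fin N)) : EuclideanSpace ℝ (Fin N) →L[ℝ] EuclideanSpace ℝ (Fin N)) =
        fun x => t • V x := funext fun x => add_sub_cancel_left x _
    rw [hsub]
    exact hlip.lipschitzOnWith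
  refine ⟨happ.toHomeomorph _ ?_, rfl, fun x => ?_⟩
  · rcases subsingleton_or_nontrivial (EuclideanSpace ℝ (Fin N)) with h | h
    · exact Or.inl h
    · right
      have : ‖((ContinuousLinearEquiv.refl ℝ (EuclideanSpace ℝ (Fin N))).symm :
        EuclideanSpace ℝ (Fin N) →L[ℝ] EuclideanSpace ℝ (Fin N))‖₊ = 1 := by
        ext
        exact ContinuousLinearMap.norm_id
      rw [this, inv_one]
      exact ht
  · have h : ‖-(t • fderiv ℝ V x)‖ < 1 := by
      rw [norm_neg, norm_smul]
      calc ‖t‖ * ‖fderiv ℝ V x‖ ≤ ‖t‖ * C := by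
            gcongr
            exact norm_fderiv_le_of_lipschitz ℝ hC
        _ < 1 := by exact_mod_cast ht
    simpa using isUnit_one_sub_of_norm_lt_one h

section

variable {N : ℕ} {U : Set (EuclideanSpace ℝ (Fin N))}

theorem integral_eq_neg_integral_inner_mul_gradient {φ : EuclideanSpace ℝ (Fin N) → ℝ}
    (hφ : ContDiff ℝ 1 φ) (hφc : HasCompactSupport φ) (hφU : tsupport φ ⊆ U)
    {e : EuclideanSpace ℝ (Fin N)} (he : ‖e‖ = 1) :
    ∫ x in U, φ x = -∫ x in U, ⟪e, x⟫ * ⟪e, gradient φ x⟫ := by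
  have hg : Continuous (gradient φ) := contDiff_continuous_gradient hφ
  have hgs : ∀ x, φ x ≠ 0 → x ∈ U := fun x hx => hφU (subset_tsupport _ hx)
  have hgt : ∀ x, gradient φ x ≠ 0 → x ∈ tsupport φ := fun x hx => by
    refine tsupport_fderiv_subset ℝ (subset_tsupport _ ?_)
    rw [Function.mem_support, ← norm_ne_zero_iff, ← norm_gradient_eq_norm_fderiv]
    simpa using hx
  rw [setIntegral_eq_integral_of_forall_compl_eq_zero fun x hx => by
      by_contra h; exact hx (hgs x h),
    setIntegral_eq_integral_of_forall_compl_eq_zero fun x hx => by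
      by_cases h : gradient φ x = 0
      · simp [h]
      · exact absurd (hφU (hgt x h)) hx]
  have hi1 : Integrable fun x => φ x := hφ.continuous.integrable_of_hasCompactSupport hφc
  have hi2 : Integrable fun x => ⟪e, x⟫ * φ x :=
    Continuous.integrable_of_hasCompactSupport (by have := hφ.continuous; fun_prop)
      hφc.mul_left
  have hi3 : Integrable fun x => ⟪e, x⟫ * ⟪e, gradient φ x⟫ := by
    refine Continuous.integrable_of_hasCompactSupport (by fun_prop) ?_
    refine HasCompactSupport.intro hφc fun x hx => ?_
    by_cases h : gradient φ x = 0
    · simp [h]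
    · exact absurd (hgt x h) hx
  have hd : ∀ x, fderiv ℝ (fun x => ⟪e, x⟫) x e = 1 := fun x => by
    rw [show (fun x => ⟪e, x⟫) = innerSL ℝ e from rfl, ContinuousLinearMap.fderiv]
    simp [he]
  have hd' : ∀ x, fderiv ℝ φ x e = ⟪e, gradient φ x⟫ := fun x => by
    rw [← inner_gradient_eq_fderiv, real_inner_comm]
  have := integral_mul_fderiv_eq_neg_fderiv_mul_of_integrable (μ := volume) (v := e)
    (f := fun x : EuclideanSpace ℝ (Fin N) => ⟪e, x⟫) (g := φ)
    (by simpa only [hd, one_mul] using hi1) (by simpa only [hd'] using hi3) hi2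
    (fun x _ => (innerSL ℝ e).differentiableAt)
    (fun x _ => hφ.differentiable one_ne_zero x)
  simp only [hd, hd', one_mul] at this
  rw [this, neg_neg]

theorem setIntegral_image_homeomorph {Φ : EuclideanSpace ℝ (Fin N) ≃ₜ EuclideanSpace ℝ (Fin N)}
    (hΦ : Differentiable ℝ Φ) (hU : MeasurableSet U) (g : EuclideanSpace ℝ (Fin N) → ℝ) :
    ∫ x in Φ '' U, g x = ∫ x in U, |(fderiv ℝ Φ x).det| * g (Φ x) :=
  integral_image_eq_integral_abs_det_fderiv_smul volume hU
    (fun x _ => (hΦ x).hasFDerivAt.hasFDerivWithinAt) Φ.injective.injOn g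

theorem inner_gradient_comp {φ : EuclideanSpace ℝ (Fin N) → ℝ}
    {Φ : EuclideanSpace ℝ (Fin N) → EuclideanSpace ℝ (Fin N)} (hφ : Differentiable ℝ φ)
    (hΦ : Differentiable ℝ Φ) (x v : EuclideanSpace ℝ (Fin N)) :
    ⟪gradient (φ ∘ Φ) x, v⟫ = ⟪gradient φ (Φ x), fderiv ℝ Φ x v⟫ := by
  rw [inner_gradient_eq_fderiv, inner_gradient_eq_fderiv, fderiv_comp x (hφ _) (hΦ x)]
  rfl

end

section

variable {N : ℕ} {Ω : Set (EuclideanSpace ℝ (Fin N))}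

theorem ContinuousLinearMap.det_ne_zero_of_isUnit {E : Type*} [NormedAddCommGroup E]
    [NormedSpace ℝ E] {F : E →L[ℝ] E} (hF : IsUnit F) : F.det ≠ 0 :=
  ((hF.map ContinuousLinearMap.toLinearMapRingHom).map LinearMap.det).ne_zero

/-- Young's inequality with weight `d`. -/
theorem inner_sub_le_of_holderConjugate {E : Type*} [NormedAddCommGroup E]
    [InnerProductSpace ℝ E] {p q : ℝ} (hpq : p.HolderConjugate q) {d : ℝ} (hd : 0 < d) (τ g : E) :
    ⟪τ, g⟫ - 1 / p * (d * ‖g‖ ^ p) ≤ 1 / q * (d ^ (1 - q) * ‖τ‖ ^ q) := by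
  have hp := hpq.pos
  have hq := hpq.symm.pos
  have h1 := Real.young_inequality_of_nonneg (a := d ^ p⁻¹ * ‖g‖) (b := d ^ (-p⁻¹) * ‖τ‖)
    (by positivity) (by positivity) hpq
  have h2 : (d ^ p⁻¹ * ‖g‖) * (d ^ (-p⁻¹) * ‖τ‖) = ‖τ‖ * ‖g‖ := by
    rw [Real.rpow_neg hd.le]
    field_simp
  have h3 : (d ^ p⁻¹ * ‖g‖) ^ p = d * ‖g‖ ^ p := by
    rw [Real.mul_rpow (by positivity) (by positivity), ← Real.rpow_mul hd.le,
      inv_mul_cancel₀ hp.ne', Real.rpow_one]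
  have h4 : (d ^ (-p⁻¹) * ‖τ‖) ^ q = d ^ (1 - q) * ‖τ‖ ^ q := by
    rw [Real.mul_rpow (by positivity) (by positivity), ← Real.rpow_mul hd.le]
    congr 2
    have := hpq.inv_add_inv_eq_one
    field_simp at this ⊢
    linarith
  rw [h2, h3, h4] at h1
  have h5 := real_inner_le_norm τ g
  rw [div_mul_eq_mul_div, div_mul_eq_mul_div, one_mul, one_mul]
  linarith

theorem IsTestFun.comp_homeomorph {φ : EuclideanSpace ℝ (Fin N) → ℝ}
    {Φ : EuclideanSpace ℝ (Fin N) ≃ₜ EuclideanSpace ℝ (Fin N)} (hφ : IsTestFun (Φ '' Ω) φ)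
    (hΦ : ContDiff ℝ (⊤ : ℕ∞) Φ) : IsTestFun Ω (φ ∘ Φ) := by
  refine ⟨hφ.1.comp hΦ, hφ.2.1.comp_homeomorph Φ, ?_⟩
  rw [tsupport_comp_eq_preimage]
  rintro x hx
  obtain ⟨z, hz, hzx⟩ := hφ.2.2 hx
  rwa [← Φ.injective hzx]

theorem IsWeakSolution.torsionEnergy_image_le {p q : ℝ} (hp : 1 < p) (hpq : p.HolderConjugate q)
    (hΩo : IsOpen Ω) (hΩc : IsCompact (closure Ω)) {y : EuclideanSpace ℝ (Fin N) → ℝ}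
    (hy : C1OnClosure Ω y) (hsol : IsWeakSolution p Ω y (fun _ => 1))
    {Φ : EuclideanSpace ℝ (Fin N) ≃ₜ EuclideanSpace ℝ (Fin N)} (hΦ : ContDiff ℝ (⊤ : ℕ∞) Φ)
    (hΦu : ∀ x, IsUnit (fderiv ℝ Φ x)) {e : EuclideanSpace ℝ (Fin N)} (he : ‖e‖ = 1)
    {φ : EuclideanSpace ℝ (Fin N) → ℝ} (hφ : IsTestFun (Φ '' Ω) φ) :
    torsionEnergy p (Φ '' Ω) φ ≤ ∫ x in Ω, 1 / q * (|(fderiv ℝ Φ x).det| ^ (1 - q) *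
      ‖fderiv ℝ Φ x (‖gradient y x‖ ^ (p - 2) • gradient y x + ⟪e, x⟫ • e) -
        (|(fderiv ℝ Φ x).det| * ⟪e, Φ x⟫) • e‖ ^ q) := by
  have hp0 : 0 < p := zero_lt_one.trans hp
  have hΦd : Differentiable ℝ Φ := hΦ.differentiable (by simp)
  have hφd : Differentiable ℝ φ := hφ.1.differentiable (by simp)
  have hψ := hφ.comp_homeomorph hΦ
  have hF : Continuous (fderiv ℝ Φ) := hΦ.continuous_fderiv (by simp)
  have hdet : Continuous fun x => |(fderiv ℝ Φ x).det| :=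
    ((ContinuousLinearMap.contDiff_det (n := 0)).continuous.comp hF).abs
  have hdpos : ∀ x, 0 < |(fderiv ℝ Φ x).det| := fun x =>
    abs_pos.2 (ContinuousLinearMap.det_ne_zero_of_isUnit (hΦu x))
  have hg : Continuous fun x => gradient φ (Φ x) :=
    (contDiff_continuous_gradient hφ.contDiff_one).comp Φ.continuous
  have hσ : ContinuousOn (fun x => ‖gradient y x‖ ^ (p - 2) • gradient y x) (closure Ω) :=
    (continuous_norm_rpow_sub_two_smul hp).comp_continuousOn hy.continuousOn_gradient
  have hint : ∀ {f : EuclideanSpace ℝ (Fin N) → ℝ}, ContinuousOn f (closure Ω) →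
      IntegrableOn f Ω := fun hf => integrableOn_of_continuousOn_closure hΩo.measurableSet hΩc hf
  have hΦc := Φ.continuous
  have hF1 : ContinuousOn (fun x => ⟪gradient φ (Φ x), fderiv ℝ Φ x
      (‖gradient y x‖ ^ (p - 2) • gradient y x)⟫) (closure Ω) :=
    hg.continuousOn.inner (hF.continuousOn.clm_apply hσ)
  have hF2 : Continuous (fun x => ⟪e, x⟫ * ⟪gradient φ (Φ x), fderiv ℝ Φ x e⟫) := by fun_prop
  have hF3 : Continuous (fun x => |(fderiv ℝ Φ x).det| * (⟪e, Φ x⟫ * ⟪e, gradient φ (Φ x)⟫)) := by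
    fun_prop
  have hF4 : Continuous (fun x => |(fderiv ℝ Φ x).det| * ‖gradient φ (Φ x)‖ ^ p) :=
    hdet.mul (hg.norm.rpow_const fun _ => Or.inr hp0.le)
  have hτ : ContinuousOn (fun x => fderiv ℝ Φ x (‖gradient y x‖ ^ (p - 2) • gradient y x +
      ⟪e, x⟫ • e) - (|(fderiv ℝ Φ x).det| * ⟪e, Φ x⟫) • e) (closure Ω) := by
    refine (hF.continuousOn.clm_apply (hσ.add ?_)).sub ?_ <;> exact Continuous.continuousOn
      (by fun_prop)
  have h1 : ∫ x in Ω, (φ ∘ Φ) x = ∫ x in Ω, ⟪gradient φ (Φ x), fderiv ℝ Φ x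
      (‖gradient y x‖ ^ (p - 2) • gradient y x)⟫ := by
    rw [← hsol.setIntegral_eq_of_contDiff_one hp hΩo hΩc hy.continuousOn_gradient
      hψ.contDiff_one hψ.2.1 hψ.2.2]
    simp only [← inner_gradient_comp hφd hΦd, real_inner_comm]
  have h2 : ∫ x in Ω, (φ ∘ Φ) x = -∫ x in Ω, ⟪e, x⟫ * ⟪gradient φ (Φ x), fderiv ℝ Φ x e⟫ := by
    rw [integral_eq_neg_integral_inner_mul_gradient hψ.contDiff_one hψ.2.1 hψ.2.2 he]
    simp only [← inner_gradient_comp hφd hΦd, real_inner_comm]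
  have h3 : ∫ x in Φ '' Ω, φ x = -∫ x in Ω, |(fderiv ℝ Φ x).det| *
      (⟪e, Φ x⟫ * ⟪e, gradient φ (Φ x)⟫) := by
    rw [integral_eq_neg_integral_inner_mul_gradient hφ.contDiff_one hφ.2.1 hφ.2.2 he,
      setIntegral_image_homeomorph hΦd hΩo.measurableSet]
  have h4 := setIntegral_image_homeomorph hΦd hΩo.measurableSet fun x => ‖gradient φ x‖ ^ p
  have key : torsionEnergy p (Φ '' Ω) φ = ∫ x in Ω,
      (⟪fderiv ℝ Φ x (‖gradient y x‖ ^ (p - 2) • gradient y x + ⟪e, x⟫ • e) -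
        (|(fderiv ℝ Φ x).det| * ⟪e, Φ x⟫) • e, gradient φ (Φ x)⟫ -
        1 / p * (|(fderiv ℝ Φ x).det| * ‖gradient φ (Φ x)‖ ^ p)) := by
    have : torsionEnergy p (Φ '' Ω) φ = (((∫ x in Ω, ⟪gradient φ (Φ x), fderiv ℝ Φ x
      (‖gradient y x‖ ^ (p - 2) • gradient y x)⟫) + ∫ x in Ω, ⟪e, x⟫ *
        ⟪gradient φ (Φ x), fderiv ℝ Φ x e⟫) - ∫ x in Ω, |(fderiv ℝ Φ x).det| *
      (⟪e, Φ x⟫ * ⟪e, gradient φ (Φ x)⟫)) -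
        ∫ x in Ω, 1 / p * (|(fderiv ℝ Φ x).det| * ‖gradient φ (Φ x)‖ ^ p) := by
      rw [torsionEnergy, h4, ← h1, integral_const_mul]
      linarith
    rw [this, ← integral_add' (hint hF1) (hint hF2.continuousOn), ← integral_sub'
      ((hint hF1).add (hint hF2.continuousOn)) (hint hF3.continuousOn), ← integral_sub'
      (((hint hF1).add (hint hF2.continuousOn)).sub (hint hF3.continuousOn))
      ((hint hF4.continuousOn).const_mul _)]
    refine integral_congr_ae (.of_forall fun x => ?_)
    simp only [Pi.add_apply, Pi.sub_apply, map_add, map_smul, inner_sub_right, inner_add_right,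
      real_inner_smul_right, real_inner_comm (gradient φ (Φ x))]
    ring
  rw [key]
  refine setIntegral_mono (hint ?_) (hint ?_) fun x =>
    inner_sub_le_of_holderConjugate hpq (hdpos x) _ _
  · exact (hτ.inner hg.continuousOn).sub (hF4.const_mul _).continuousOn
  · exact continuousOn_const.mul ((hdet.rpow_const fun x =>
      Or.inl (hdpos x).ne').continuousOn.mul (hτ.norm.rpow_const fun _ _ =>
      Or.inr hpq.symm.nonneg))

theorem IsWeakSolution.le_of_torsionEnergy_image_le {p : ℝ} (hp : 1 < p)
    (hΩo : IsOpen Ω) (hΩc : IsCompact (closure Ω)) {y : EuclideanSpace ℝ (Fin N) → ℝ}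
    (hy : C1OnClosure Ω y) (hy0 : ∀ x ∈ frontier Ω, y x = 0)
    (hsol : IsWeakSolution p Ω y (fun _ => 1))
    {Φ : EuclideanSpace ℝ (Fin N) ≃ₜ EuclideanSpace ℝ (Fin N)} (hΦ : ContDiff ℝ (⊤ : ℕ∞) Φ)
    (hΦu : ∀ x, IsUnit (fderiv ℝ Φ x)) {B : ℝ}
    (hB : ∀ φ, IsTestFun (Φ '' Ω) φ → torsionEnergy p (Φ '' Ω) φ ≤ B) :
    (∫ x in Ω, |(fderiv ℝ Φ x).det| * y x) - 1 / p * ∫ x in Ω, |(fderiv ℝ Φ x).det| *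
      ‖ContinuousLinearMap.adjoint (Ring.inverse (fderiv ℝ Φ x)) (gradient y x)‖ ^ p ≤ B := by
  have hp0 : 0 < p := zero_lt_one.trans hp
  have hΦd : Differentiable ℝ Φ := hΦ.differentiable (by simp)
  have hF : Continuous (fderiv ℝ Φ) := hΦ.continuous_fderiv (by simp)
  have hdet : Continuous fun x => |(fderiv ℝ Φ x).det| :=
    ((ContinuousLinearMap.contDiff_det (n := 0)).continuous.comp hF).abs
  have hA : Continuous fun x => ContinuousLinearMap.adjoint (Ring.inverse (fderiv ℝ Φ x)) := by
    refine ContinuousLinearMap.adjoint.continuous.comp (continuous_iff_continuousAt.2 fun x => ?_)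
    obtain ⟨u, hu⟩ := hΦu x
    have h := NormedRing.inverse_continuousAt u
    rw [hu] at h
    exact h.comp hF.continuousAt
  have hΩμ : volume Ω < ⊤ := (measure_mono subset_closure).trans_lt hΩc.measure_lt_top
  obtain ⟨ψ, C, hψ, h0, h1, hC0, hC1⟩ := hsol.exists_seq_tendsto hp hΩo hΩc hy hy0
  obtain ⟨D, hD⟩ := hΩc.exists_bound_of_continuousOn hdet.continuousOn
  obtain ⟨K, hK⟩ := hΩc.exists_bound_of_continuousOn hA.continuousOn
  choose u hu using hΦu
  have hΦs : ContDiff ℝ 1 Φ.symm := (Φ.contDiff_symm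
    (f₀' := fun x => ContinuousLinearEquiv.unitsEquiv ℝ _ (u x))
    (fun x => by
      have h := (hΦd x).hasFDerivAt
      rwa [← hu x] at h) hΦ).of_le (by simp)
  have himg : IsOpen (Φ '' Ω) := Φ.isOpenMap _ hΩo
  have himgμ : volume (Φ '' Ω) < ⊤ := (measure_mono (image_mono subset_closure)).trans_lt
    (hΩc.image Φ.continuous).measure_lt_top
  have hgrad : ∀ n x, gradient (ψ n ∘ Φ.symm) (Φ x) =
      ContinuousLinearMap.adjoint (Ring.inverse (fderiv ℝ Φ x)) (gradient (ψ n) x) := by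
    refine fun n x => ext_inner_right ℝ fun v => ?_
    have h := inner_gradient_comp (φ := ψ n ∘ Φ.symm)
      (((hψ n).1.comp hΦs).differentiable one_ne_zero) hΦd x (Ring.inverse (fderiv ℝ Φ x) v)
    rw [ContinuousLinearMap.adjoint_inner_left, ← mul_apply_eq_comp,
      Ring.mul_inverse_cancel _ ⟨u x, hu x⟩, one_apply_eq_self] at *
    rw [← h, Function.comp_assoc, Φ.symm_comp_self, Function.comp_id]
  have hE : ∀ n, (∫ x in Ω, |(fderiv ℝ Φ x).det| * ψ n x) - 1 / p * ∫ x in Ω,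
      |(fderiv ℝ Φ x).det| * ‖ContinuousLinearMap.adjoint (Ring.inverse (fderiv ℝ Φ x))
        (gradient (ψ n) x)‖ ^ p ≤ B := fun n => by
    have h := torsionEnergy_le_of_forall_isTestFun hp0 himg himgμ ((hψ n).1.comp hΦs)
      ((hψ n).2.1.comp_homeomorph Φ.symm) (by
        rw [tsupport_comp_eq_preimage, ← Φ.image_eq_preimage_symm]
        exact image_mono (hψ n).2.2) hB
    rw [torsionEnergy, setIntegral_image_homeomorph hΦd hΩo.measurableSet,
      setIntegral_image_homeomorph hΦd hΩo.measurableSet] at h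
    simpa only [hgrad, Function.comp_apply, Φ.symm_apply_apply] using h
  refine le_of_tendsto' (x := atTop) (Tendsto.sub ?_ (Tendsto.const_mul _ ?_)) hE
  · refine tendsto_setIntegral_of_continuousOn_of_bounded (C := D * C) hΩo.measurableSet hΩμ
      (fun n => (hdet.mul (hψ n).1.continuous).continuousOn) (fun n x hx => ?_)
      fun x hx => (h0 x hx).const_mul _
    rw [norm_mul]
    exact mul_le_mul (hD x (subset_closure hx)) (hC0 n x hx) (norm_nonneg _)
      ((norm_nonneg _).trans (hD x (subset_closure hx)))
  · refine tendsto_setIntegral_of_continuousOn_of_bounded (C := D * (K * C) ^ p)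
      hΩo.measurableSet hΩμ
      (fun n => (hdet.mul ((hA.clm_apply (contDiff_continuous_gradient (hψ n).1)).norm.rpow_const
        fun _ => Or.inr hp0.le)).continuousOn) (fun n x hx => ?_)
      fun x hx => ((((ContinuousLinearMap.continuous _).tendsto _).comp (h1 x hx)).norm.rpow_const
        (Or.inr hp0.le)).const_mul _
    have hKx := hK x (subset_closure hx)
    have hb := (ContinuousLinearMap.le_opNorm (ContinuousLinearMap.adjoint
      (Ring.inverse (fderiv ℝ Φ x))) (gradient (ψ n) x)).trans
      (mul_le_mul hKx (hC1 n x hx) (norm_nonneg _) ((norm_nonneg _).trans hKx))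
    rw [norm_mul, Real.norm_of_nonneg (Real.rpow_nonneg (norm_nonneg _) p)]
    exact mul_le_mul (hD x (subset_closure hx)) (Real.rpow_le_rpow (norm_nonneg _) hb hp0.le)
      (by positivity) ((norm_nonneg _).trans (hD x (subset_closure hx)))

end

section

variable {E : Type*} [NormedAddCommGroup E] [InnerProductSpace ℝ E]

theorem one_add_zero_smul (M : E →L[ℝ] E) : 1 + (0 : ℝ) • M = 1 := by simp

theorem contDiff_one_add_smul {X : Type*} [NormedAddCommGroup X] [NormedSpace ℝ X] :
    ContDiff ℝ 1 fun z : ℝ × X × (E →L[ℝ] E) => 1 + z.1 • z.2.2 := by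
  fun_prop

theorem ContDiffAt.abs_det [FiniteDimensional ℝ E] {X : Type*} [NormedAddCommGroup X]
    [NormedSpace ℝ X] {F : X → E →L[ℝ] E} {x : X}
    (hF : ContDiffAt ℝ 1 F x) (hx : IsUnit (F x)) :
    ContDiffAt ℝ 1 (fun x => |(F x).det|) x :=
  ContDiffAt.fun_comp x (contDiffAt_abs (n := 1) (ContinuousLinearMap.det_ne_zero_of_isUnit hx))
    (ContDiffAt.fun_comp x ContinuousLinearMap.contDiff_det.contDiffAt hF)

theorem hasDerivAt_abs_det_one_add_smul [FiniteDimensional ℝ E]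
    (M : E →L[ℝ] E) :
    HasDerivAt (fun t : ℝ => |(1 + t • M).det|)
      (LinearMap.trace ℝ E M) 0 := by
  have h := ContinuousLinearMap.hasDerivAt_det_one_add_smul M
  have h1 : (1 + (0 : ℝ) • M).det = 1 := by
    rw [one_add_zero_smul]
    exact LinearMap.det_id
  have h2 := (hasDerivAt_abs_pos (by rw [h1]; exact one_pos)).comp (0 : ℝ) h
  rwa [one_mul] at h2

variable [CompleteSpace E]

theorem isBoundedLinearMap_adjoint : IsBoundedLinearMap ℝ
    fun A : E →L[ℝ] E =>
      ContinuousLinearMap.adjoint A :=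
  { map_add := map_add _
    map_smul := fun c A => by simp
    bound := ⟨1, one_pos, fun A => by simp⟩ }

theorem ContDiffAt.adjoint_ringInverse {X : Type*} [NormedAddCommGroup X] [NormedSpace ℝ X]
    {F : X → E →L[ℝ] E} {x : X}
    (hF : ContDiffAt ℝ 1 F x) (hx : IsUnit (F x)) :
    ContDiffAt ℝ 1 (fun x => ContinuousLinearMap.adjoint (Ring.inverse (F x))) x := by
  obtain ⟨u, hu⟩ := hx
  refine ContDiffAt.fun_comp x isBoundedLinearMap_adjoint.contDiff.contDiffAt
    (ContDiffAt.fun_comp x ?_ hF)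
  rw [← hu]
  exact contDiffAt_ringInverse ℝ u

theorem hasDerivAt_adjoint_inverse_one_add_smul
    (M : E →L[ℝ] E)
    (v : E) :
    HasDerivAt (fun t : ℝ => ContinuousLinearMap.adjoint (Ring.inverse (1 + t • M)) v)
      (-ContinuousLinearMap.adjoint M v) 0 := by
  have h0 : HasDerivAt (fun t : ℝ => 1 + t • M) M 0 := by
    simpa using ((hasDerivAt_id (0 : ℝ)).smul_const M).const_add 1
  have h1 := hasFDerivAt_ringInverse (𝕜 := ℝ)
    (1 : (E →L[ℝ] E)ˣ)
  have h1' : HasDerivAt (fun t : ℝ => Ring.inverse (1 + t • M)) (-M) 0 := by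
    have := h1.comp_hasDerivAt_of_eq (0 : ℝ) h0 (by simp)
    simp at this
    exact this
  have hL : IsBoundedLinearMap ℝ fun A : E →L[ℝ] E => ContinuousLinearMap.adjoint A v :=
    (ContinuousLinearMap.apply ℝ E v).isBoundedLinearMap.comp isBoundedLinearMap_adjoint
  have h2 := hL.toContinuousLinearMap.hasFDerivAt.comp_hasDerivAt (0 : ℝ) h1'
  refine h2.congr_deriv ?_
  change ContinuousLinearMap.adjoint (-M) v = _
  rw [map_neg]
  rfl

theorem isOpen_setOf_isUnit_one_add_smul {X : Type*} [NormedAddCommGroup X] [NormedSpace ℝ X] :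
    IsOpen {z : ℝ × X × (E →L[ℝ] E) | IsUnit (1 + z.1 • z.2.2)} :=
  Units.isOpen.preimage contDiff_one_add_smul.continuous

variable [FiniteDimensional ℝ E]

theorem hasDerivAt_abs_det_mul_norm_rpow {p : ℝ} (hp : 1 < p)
    (M : E →L[ℝ] E)
    (v : E) :
    HasDerivAt (fun t : ℝ => |(1 + t • M).det| *
        ‖ContinuousLinearMap.adjoint (Ring.inverse (1 + t • M)) v‖ ^ p)
      (LinearMap.trace ℝ E M * ‖v‖ ^ p -
        p * (‖v‖ ^ (p - 2) * ⟪v, M v⟫)) 0 := by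
  have hv : ContinuousLinearMap.adjoint (Ring.inverse (1 + (0 : ℝ) • M)) v = v := by
    simp [← ContinuousLinearMap.star_eq_adjoint]
  have hd : |(1 + (0 : ℝ) • M).det| = 1 := by
    rw [one_add_zero_smul, show (1 : E →L[ℝ]
      E).det = 1 from LinearMap.det_id, abs_one]
  have h := (hasDerivAt_abs_det_one_add_smul M).mul
    ((hasFDerivAt_norm_rpow v hp).comp_hasDerivAt_of_eq (0 : ℝ)
      (hasDerivAt_adjoint_inverse_one_add_smul M v) hv.symm)
  refine h.congr_deriv ?_
  simp only [Function.comp_apply, hv, hd]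
  simp [ContinuousLinearMap.adjoint_inner_right, real_inner_comm (M v)]
  ring

variable [MeasurableSpace E] [BorelSpace E] {μ : Measure E} [IsFiniteMeasureOnCompacts μ]
  {Ω : Set E} {M : E → E →L[ℝ] E}

theorem hasDerivAt_setIntegral_abs_det_mul (hΩo : IsOpen Ω) (hΩc : IsCompact (closure Ω))
    {f : E → ℝ} (hf : ContinuousOn f (closure Ω)) (hM : Continuous M) :
    HasDerivAt (fun t : ℝ => ∫ x in Ω, |(1 + t • M x).det| * f x ∂μ)
      (∫ x in Ω, LinearMap.trace ℝ E (M x) * f x ∂μ) 0 := by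
  refine hasDerivAt_integral_of_contDiffOn (O := {z | IsUnit (1 + z.1 • z.2.2)})
    (G := fun z : ℝ × ℝ × (E →L[ℝ] E) =>
      |(1 + z.1 • z.2.2).det| * z.2.1) (a := fun x => (f x, M x)) hΩo hΩc
    (hf.prodMk hM.continuousOn) isOpen_setOf_isUnit_one_add_smul ?_ (by simp) fun x _ =>
      (hasDerivAt_abs_det_one_add_smul (M x)).mul_const _
  exact fun z hz =>
    ((contDiff_one_add_smul.contDiffAt.abs_det hz).mul (by fun_prop)).contDiffWithinAt

theorem hasDerivAt_setIntegral_abs_det_mul_norm_rpow {p : ℝ} (hp : 1 < p) (hΩo : IsOpen Ω)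
    (hΩc : IsCompact (closure Ω)) {w : E → E}
    (hw : ContinuousOn w (closure Ω)) (hM : Continuous M) :
    HasDerivAt (fun t : ℝ => ∫ x in Ω, |(1 + t • M x).det| *
        ‖ContinuousLinearMap.adjoint (Ring.inverse (1 + t • M x)) (w x)‖ ^ p ∂μ)
      (∫ x in Ω, (LinearMap.trace ℝ E (M x) * ‖w x‖ ^ p -
        p * (‖w x‖ ^ (p - 2) * ⟪w x, M x (w x)⟫)) ∂μ) 0 := by
  refine hasDerivAt_integral_of_contDiffOn (O := {z | IsUnit (1 + z.1 • z.2.2)})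
    (G := fun z : ℝ × E × (E →L[ℝ] E) =>
      |(1 + z.1 • z.2.2).det| *
        ‖ContinuousLinearMap.adjoint (Ring.inverse (1 + z.1 • z.2.2)) z.2.1‖ ^ p)
    (a := fun x => (w x, M x)) hΩo hΩc
    (hw.prodMk hM.continuousOn) isOpen_setOf_isUnit_one_add_smul ?_ (by simp) fun x _ =>
      hasDerivAt_abs_det_mul_norm_rpow hp (M x) (w x)
  exact fun z hz => ((contDiff_one_add_smul.contDiffAt.abs_det hz).mul
    ((contDiff_norm_rpow hp).contDiffAt.comp z
      ((contDiff_one_add_smul.contDiffAt.adjoint_ringInverse hz).clm_apply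
        (by fun_prop)))).contDiffWithinAt

theorem differentiableAt_setIntegral_abs_det_rpow_mul_norm_rpow {q : ℝ} (hq : 1 < q)
    (hΩo : IsOpen Ω) (hΩc : IsCompact (closure Ω))
    {σ v : E → E} (hσ : ContinuousOn σ (closure Ω)) (hv : Continuous v) (hM : Continuous M)
    (e : E) :
    DifferentiableAt ℝ (fun t : ℝ => ∫ x in Ω, 1 / q * (|(1 + t • M x).det| ^ (1 - q) *
      ‖(1 + t • M x) (σ x + ⟪e, x⟫ • e) - (|(1 + t • M x).det| * ⟪e, x + t • v x⟫) • e‖ ^ q) ∂μ)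
      0 := by
  set G : ℝ × (E × E × E) × (E →L[ℝ] E) → ℝ := fun z =>
    1 / q * (|(1 + z.1 • z.2.2).det| ^ (1 - q) *
      ‖(1 + z.1 • z.2.2) (z.2.1.1 + ⟪e, z.2.1.2.1⟫ • e) -
        (|(1 + z.1 • z.2.2).det| * ⟪e, z.2.1.2.1 + z.1 • z.2.1.2.2⟫) • e‖ ^ q) with hG
  have hGd : ∀ z, IsUnit (1 + z.1 • z.2.2) → ContDiffAt ℝ 1 G z := fun z hz => by
    have hd : ContDiffAt ℝ 1 (fun z : ℝ × (E × E × E) × (E →L[ℝ] E) =>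
        |(1 + z.1 • z.2.2).det|) z := ContDiffAt.abs_det (by fun_prop) hz
    refine contDiffAt_const.mul ((hd.rpow_const_of_ne (abs_ne_zero.2
      (ContinuousLinearMap.det_ne_zero_of_isUnit hz))).mul
      ((contDiff_norm_rpow hq).contDiffAt.comp z (ContDiffAt.sub ?_ ?_)))
    · exact ContDiffAt.clm_apply (by fun_prop) ((by fun_prop : ContDiffAt ℝ 1 _ _).add
        ((contDiffAt_const.inner ℝ (by fun_prop)).smul contDiffAt_const))
    · exact (hd.mul (contDiffAt_const.inner ℝ (by fun_prop))).smul contDiffAt_const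
  refine (hasDerivAt_integral_of_contDiffOn (O := {z | IsUnit (1 + z.1 • z.2.2)})
    (G := G) (a := fun x => ((σ x, x, v x), M x)) hΩo hΩc
    ((hσ.prodMk (continuousOn_id.prodMk hv.continuousOn)).prodMk hM.continuousOn)
    isOpen_setOf_isUnit_one_add_smul (fun z hz => (hGd z hz).contDiffWithinAt) (by simp)
    fun x _ => DifferentiableAt.hasDerivAt ?_).differentiableAt
  exact DifferentiableAt.comp (g := G) (f := fun t : ℝ => (t, ((σ x, x, v x), M x))) (0 : ℝ)
    ((hGd _ (by simp)).differentiableAt one_ne_zero) (by fun_prop)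

end

section

variable {N : ℕ} {Ω : Set (EuclideanSpace ℝ (Fin N))} {p : ℝ}

theorem fderiv_id_add_smul {V : EuclideanSpace ℝ (Fin N) → EuclideanSpace ℝ (Fin N)}
    (hV : Differentiable ℝ V) (t : ℝ) (x : EuclideanSpace ℝ (Fin N)) :
    fderiv ℝ (fun x => x + t • V x) x = 1 + t • fderiv ℝ V x :=
  ((hasFDerivAt_id x).add ((hV x).hasFDerivAt.const_smul t)).fderiv

theorem torsionSup_le {U : Set (EuclideanSpace ℝ (Fin N))} {B : ℝ}
    (hB : ∀ φ, IsTestFun U φ → torsionEnergy p U φ ≤ B) : torsionSup p U ≤ B :=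
  csSup_le ⟨_, 0, ⟨contDiff_const, HasCompactSupport.zero, by simp [tsupport]⟩, rfl⟩
    (by rintro _ ⟨φ, hφ, rfl⟩; exact hB φ hφ)

theorem torsionEnergy_le_torsionSup {U : Set (EuclideanSpace ℝ (Fin N))} {B : ℝ}
    (hB : ∀ φ, IsTestFun U φ → torsionEnergy p U φ ≤ B) {φ : EuclideanSpace ℝ (Fin N) → ℝ}
    (hφ : IsTestFun U φ) : torsionEnergy p U φ ≤ torsionSup p U :=
  le_csSup ⟨B, by rintro _ ⟨φ, hφ, rfl⟩; exact hB φ hφ⟩ ⟨φ, hφ, rfl⟩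

theorem IsWeakSolution.nontrivial {y : EuclideanSpace ℝ (Fin N) → ℝ} (hΩo : IsOpen Ω)
    (hΩ : Ω.Nonempty) (hΩμ : volume Ω < ⊤) (hsol : IsWeakSolution p Ω y (fun _ => 1)) :
    Nontrivial (EuclideanSpace ℝ (Fin N)) := by
  by_contra h
  rw [not_nontrivial_iff_subsingleton] at h
  have hΩu : Ω = univ := eq_univ_of_forall fun x => by
    obtain ⟨z, hz⟩ := hΩ
    rwa [Subsingleton.elim x z]
  have h1 := hsol (fun _ => 1) ⟨contDiff_const, HasCompactSupport.of_compactSpace _, by simp [hΩu]⟩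
  have h2 : ∀ v w : EuclideanSpace ℝ (Fin N), ⟪v, w⟫ = 0 := fun v w => by
    rw [Subsingleton.elim v 0, inner_zero_left]
  simp only [h2, mul_zero, integral_zero, mul_one, integral_const, smul_eq_mul,
    measureReal_restrict_apply_univ] at h1
  exact (ENNReal.toReal_pos (hΩo.measure_pos volume hΩ).ne' hΩμ.ne).ne h1

theorem IsWeakSolution.hasDerivAt_torsionSup (hp : 1 < p) (hΩo : IsOpen Ω) (hΩ : Ω.Nonempty)
    (hΩc : IsCompact (closure Ω)) {y : EuclideanSpace ℝ (Fin N) → ℝ}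
    (hy : C1OnClosure Ω y) (hy0 : ∀ x ∈ frontier Ω, y x = 0)
    (hsol : IsWeakSolution p Ω y (fun _ => 1))
    {V : EuclideanSpace ℝ (Fin N) → EuclideanSpace ℝ (Fin N)}
    (hV : ContDiff ℝ (⊤ : ℕ∞) V) (hVc : HasCompactSupport V) :
    HasDerivAt (fun t : ℝ => torsionSup p ((fun x => x + t • V x) '' Ω))
      ((∫ x in Ω, divergence V x * y x) - 1 / p * ∫ x in Ω,
        (divergence V x * ‖gradient y x‖ ^ p -
          p * (‖gradient y x‖ ^ (p - 2) * ⟪gradient y x, fderiv ℝ V x (gradient y x)⟫))) 0 := by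
  have hΩμ : volume Ω < ⊤ := (measure_mono subset_closure).trans_lt hΩc.measure_lt_top
  have := hsol.nontrivial hΩo hΩ hΩμ
  obtain ⟨e, he⟩ := exists_norm_eq (EuclideanSpace ℝ (Fin N)) zero_le_one
  have hpq := Real.HolderConjugate.conjExponent hp
  set q := p.conjExponent
  have hM : Continuous (fderiv ℝ V) := hV.continuous_fderiv (by simp)
  have hVd : Differentiable ℝ V := hV.differentiable (by simp)
  have hσ : ContinuousOn (fun x => ‖gradient y x‖ ^ (p - 2) • gradient y x) (closure Ω) :=
    (continuous_norm_rpow_sub_two_smul hp).comp_continuousOn hy.continuousOn_gradient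
  have hL := (hasDerivAt_setIntegral_abs_det_mul (μ := volume) hΩo hΩc hy.continuousOn hM).sub
    ((hasDerivAt_setIntegral_abs_det_mul_norm_rpow (μ := volume) hp hΩo hΩc
      hy.continuousOn_gradient hM).const_mul (1 / p))
  have hU := (differentiableAt_setIntegral_abs_det_rpow_mul_norm_rpow (μ := volume)
    hpq.symm.lt hΩo hΩc hσ hV.continuous hM e).hasDerivAt
  have hB : ∀ᶠ t in 𝓝 (0 : ℝ), (∫ x in Ω, |(1 + t • fderiv ℝ V x).det| * y x) -
      1 / p * ∫ x in Ω, |(1 + t • fderiv ℝ V x).det| *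
        ‖ContinuousLinearMap.adjoint (Ring.inverse (1 + t • fderiv ℝ V x)) (gradient y x)‖ ^ p ≤
      torsionSup p ((fun x => x + t • V x) '' Ω) ∧
      torsionSup p ((fun x => x + t • V x) '' Ω) ≤
        ∫ x in Ω, 1 / q * (|(1 + t • fderiv ℝ V x).det| ^ (1 - q) *
          ‖(1 + t • fderiv ℝ V x) (‖gradient y x‖ ^ (p - 2) • gradient y x + ⟪e, x⟫ • e) -
            (|(1 + t • fderiv ℝ V x).det| * ⟪e, x + t • V x⟫) • e‖ ^ q) := by
    filter_upwards [eventually_exists_homeomorph_add_smul hV hVc] with t ⟨Φ, hΦ, hΦu⟩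
    have hΦd : ContDiff ℝ (⊤ : ℕ∞) Φ := by
      rw [hΦ]
      fun_prop
    have hF : ∀ x, fderiv ℝ Φ x = 1 + t • fderiv ℝ V x := by
      rw [hΦ]
      exact fderiv_id_add_smul hVd t
    simp only [← hF] at hΦu ⊢
    rw [← hΦ]
    have hle := fun φ (hφ : IsTestFun (Φ '' Ω) φ) =>
      hsol.torsionEnergy_image_le hp hpq hΩo hΩc hy hΦd hΦu he hφ
    refine ⟨hsol.le_of_torsionEnergy_image_le hp hΩo hΩc hy hy0 hΦd hΦu fun φ hφ =>
      torsionEnergy_le_torsionSup hle hφ, ?_⟩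
    have := torsionSup_le hle
    simpa only [hΦ] using this
  refine hL.of_le_of_le hU (hB.mono fun t h => h.1) (hB.mono fun t h => h.2) ?_
  have hdet : (1 : EuclideanSpace ℝ (Fin N) →L[ℝ] EuclideanSpace ℝ (Fin N)).det = 1 :=
    LinearMap.det_id
  have hq : ∀ x, ‖‖gradient y x‖ ^ (p - 2) • gradient y x‖ ^ q = ‖gradient y x‖ ^ p := fun x => by
    rw [norm_rpow_sub_two_smul hp, ← Real.rpow_mul (norm_nonneg _), hpq.sub_one_mul_conj]
  have hadj : ContinuousLinearMap.adjoint
      (1 : EuclideanSpace ℝ (Fin N) →L[ℝ] EuclideanSpace ℝ (Fin N)) = 1 := star_one _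
  simp only [hdet, abs_one, Real.one_rpow, one_mul, Ring.inverse_one, hadj,
    one_apply_eq_self, zero_smul, add_zero, add_sub_cancel_right, hq, Pi.sub_apply,
    integral_const_mul]
  rw [hsol.setIntegral_eq_norm_rpow hp hΩo hΩc hy hy0]
  have := hpq.inv_add_inv_eq_one
  rw [← sub_nonneg]
  have h : ∀ I : ℝ, I - 1 / p * I - 1 / q * I = (1 - (p⁻¹ + q⁻¹)) * I := fun I => by ring
  rw [h, this]
  simp

end

end HadamardAuxiliary

/-- Proposition 5.1, volume form of the Hadamard formula for the `p`-torsional rigidity: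
`t ↦ E(Φ_t(Ω))` is differentiable at `0` with
`E'(0) = (p/(p-1)) [∫ (div V) y + ∫ |∇y|^{p-2} ⟨(DV)ᵀ ∇y, ∇y⟩ - (1/p) ∫ (div V)|∇y|^p]`. -/
theorem hadamard_formula_torsion
    (N : ℕ) (p : ℝ) (hp : 1 < p) (Ω : Set (EuclideanSpace ℝ (Fin N)))
    (hΩo : IsOpen Ω) (hΩconn : IsConnected Ω) (hΩbdd : Bornology.IsBounded Ω)
    (hΩsm : HasSmoothBoundary Ω)
    (V : EuclideanSpace ℝ (Fin N) → EuclideanSpace ℝ (Fin N))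
    (hV : ContDiff ℝ (⊤ : ℕ∞) V) (hVsupp : HasCompactSupport V)
    (y : EuclideanSpace ℝ (Fin N) → ℝ)
    (hy1 : C1OnClosure Ω y) (hy0 : ∀ x ∈ frontier Ω, y x = 0)
    (hysol : IsWeakSolution p Ω y (fun _ => 1)) :
    HasDerivAt (fun t : ℝ => pTorsionalRigidity p ((fun x => x + t • V x) '' Ω))
      ((p / (p - 1)) *
        ((∫ x in Ω, divergence V x * y x)
          + (∫ x in Ω, ‖gradient y x‖ ^ (p - 2) * ⟪gradient y x, fderiv ℝ V x (gradient y x)⟫)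
          - (1 / p) * ∫ x in Ω, divergence V x * ‖gradient y x‖ ^ p)) 0 := by
  have hΩc : IsCompact (closure Ω) := hΩbdd.isCompact_closure
  have h := (hysol.hasDerivAt_torsionSup hp hΩo hΩconn.nonempty hΩc hy1 hy0 hV hVsupp).const_mul
    (p / (p - 1))
  have hp0 : 0 < p := zero_lt_one.trans hp
  have hM : Continuous (fderiv ℝ V) := hV.continuous_fderiv (by simp)
  have hdiv : Continuous (divergence V) :=
    ((LinearMap.trace ℝ (EuclideanSpace ℝ (Fin N))) ∘ₗ
      ContinuousLinearMap.coeLM ℝ).continuous_of_finiteDimensional.comp hM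
  have hσ : ContinuousOn (fun x => ‖gradient y x‖ ^ (p - 2) • gradient y x) (closure Ω) :=
    (continuous_norm_rpow_sub_two_smul hp).comp_continuousOn hy1.continuousOn_gradient
  have h1 : IntegrableOn (fun x => divergence V x * ‖gradient y x‖ ^ p) Ω :=
    integrableOn_of_continuousOn_closure hΩo.measurableSet hΩc (hdiv.continuousOn.mul
      (hy1.continuousOn_gradient.norm.rpow_const fun _ _ => Or.inr hp0.le))
  have h2 : IntegrableOn (fun x => ‖gradient y x‖ ^ (p - 2) *
      ⟪gradient y x, fderiv ℝ V x (gradient y x)⟫) Ω := by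
    refine integrableOn_of_continuousOn_closure hΩo.measurableSet hΩc ?_
    simp only [← real_inner_smul_left]
    exact hσ.inner (hM.continuousOn.clm_apply hy1.continuousOn_gradient)
  rw [integral_sub h1 (h2.const_mul p), integral_const_mul] at h
  refine h.congr_deriv ?_
  field_simp
  ring

end
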